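/- arXiv:1809.00943 — 2 statements merged into one kernel-verified Lean document; each statement's English description precedes it below -/
import Mathlib

section
/- The Gödel–Löb logic GL enjoys ULIP; moreover, for every formula φ and all finite sets P, Q of propositional variables there exists a uniform Lyndon interpolant θ of (φ,P,Q) in GL with d(θ) ≤ 3n(φ)+3. -/
/-- Modal formulas: propositional variables, ⊥, →, □. -/
inductive Formula : Type
  | var : ℕ → Formula
  | bot : Formula
  | imp : Formula → Formula → Formula
  | box : Formula → Formula
  deriving DecidableEq

namespace Formula

def neg (φ : Formula) : Formula := φ.imp bot

def top : Formula := neg bot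

def and (φ ψ : Formula) : Formula := (φ.imp ψ.neg).neg

def iff (φ ψ : Formula) : Formula := (φ.imp ψ).and (ψ.imp φ)

def dia (φ : Formula) : Formula := φ.neg.box.neg

/-- Variables occurring positively (`true`) / negatively (`false`). -/
def vsgn : Formula → Bool → Finset ℕ
  | var p, true => {p}
  | var _, false => ∅
  | bot, _ => ∅
  | imp φ ψ, b => vsgn φ (!b) ∪ vsgn ψ b
  | box φ, b => vsgn φ b

def vpos (φ : Formula) : Finset ℕ := vsgn φ true
def vneg (φ : Formula) : Finset ℕ := vsgn φ false
def vars (φ : Formula) : Finset ℕ := vpos φ ∪ vneg φ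

/-- Modal depth. -/
def depth : Formula → ℕ
  | var _ => 0
  | bot => 0
  | imp φ ψ => max (depth φ) (depth ψ)
  | box φ => depth φ + 1

/-- Uniform substitution. -/
def subst (σ : ℕ → Formula) : Formula → Formula
  | var p => σ p
  | bot => bot
  | imp φ ψ => (subst σ φ).imp (subst σ ψ)
  | box φ => (subst σ φ).box

/-- The set of subformulas. -/
def subfmls : Formula → Finset Formula
  | var p => {var p}
  | bot => {bot}
  | imp φ ψ => insert (imp φ ψ) (subfmls φ ∪ subfmls ψ)
  | box φ => insert (box φ) (subfmls φ)

/-- n(φ) = |{ψ : □ψ ∈ Sub(φ)}|. -/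
def boxCount (φ : Formula) : ℕ :=
  ((subfmls φ).filter fun ψ => box ψ ∈ subfmls φ).card

/-- The translation ⋆ : p⋆ = p, ⊥⋆ = ⊥, (φ→ψ)⋆ = φ⋆→ψ⋆, (□φ)⋆ = φ⋆ ∧ □φ⋆. -/
def star : Formula → Formula
  | var p => var p
  | bot => bot
  | imp φ ψ => (star φ).imp (star ψ)
  | box φ => (star φ).and (star φ).box

end Formula

/-- Propositional tautology: true under every valuation treating variables and
boxed formulas as atoms. -/
def Tautology (φ : Formula) : Prop :=
  ∀ v : Formula → Bool, v .bot = false →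
    (∀ ψ θ : Formula, v (ψ.imp θ) = (!v ψ || v θ)) → v φ = true

/-- A normal modal logic: contains all tautologies and □(p→q)→(□p→□q), and is
closed under modus ponens, necessitation and uniform substitution. -/
structure IsNormal (L : Set Formula) : Prop where
  taut : ∀ φ, Tautology φ → φ ∈ L
  axK : ((Formula.var 0).imp (Formula.var 1)).box.imp
      ((Formula.var 0).box.imp (Formula.var 1).box) ∈ L
  mp : ∀ φ ψ : Formula, φ.imp ψ ∈ L → φ ∈ L → ψ ∈ L
  nec : ∀ φ : Formula, φ ∈ L → φ.box ∈ L
  subst_mem : ∀ φ ∈ L, ∀ σ : ℕ → Formula, Formula.subst σ φ ∈ L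

/-- The least normal modal logic including `X`. -/
def NormalExt (X : Set Formula) : Set Formula :=
  ⋂₀ {L : Set Formula | IsNormal L ∧ X ⊆ L}

/-- The least normal modal logic K. -/
def TheoryK : Set Formula := NormalExt ∅

def axT : Formula := (Formula.var 0).box.imp (Formula.var 0)
def ax4 : Formula := (Formula.var 0).box.imp (Formula.var 0).box.box
def axB : Formula := (Formula.var 0).imp (Formula.var 0).dia.box
def axD : Formula := Formula.bot.box.neg
def axGL : Formula := ((Formula.var 0).box.imp (Formula.var 0)).box.imp (Formula.var 0).box
def axGrz : Formula :=
  (((Formula.var 0).imp (Formula.var 0).box).box.imp (Formula.var 0)).box.imp (Formula.var 0)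

def TheoryKD : Set Formula := NormalExt {axD}
def TheoryKT : Set Formula := NormalExt {axT}
def TheoryKB : Set Formula := NormalExt {axB}
def TheoryKDB : Set Formula := NormalExt {axD, axB}
def TheoryKTB : Set Formula := NormalExt {axT, axB}
def TheoryK4 : Set Formula := NormalExt {ax4}
def TheoryS4 : Set Formula := NormalExt {axT, ax4}
def TheoryGL : Set Formula := NormalExt {axGL}
def TheoryGrz : Set Formula := NormalExt {axGrz}

/-- L⋆ := {φ : L ⊢ φ⋆}. -/
def starLogic (L : Set Formula) : Set Formula := {φ | Formula.star φ ∈ L}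

/-- θ is a uniform Lyndon interpolant of (φ, P, Q) in L. -/
def IsULInterpolant (L : Set Formula) (φ : Formula) (P Q : Finset ℕ) (θ : Formula) : Prop :=
  θ.vpos ⊆ φ.vpos \ P ∧ θ.vneg ⊆ φ.vneg \ Q ∧ φ.imp θ ∈ L ∧
    ∀ ψ : Formula, ψ.vpos ∩ P = ∅ → ψ.vneg ∩ Q = ∅ → φ.imp ψ ∈ L → θ.imp ψ ∈ L

/-- The uniform Lyndon interpolation property. -/
def ULIP (L : Set Formula) : Prop :=
  ∀ (φ : Formula) (P Q : Finset ℕ), ∃ θ : Formula, IsULInterpolant L φ P Q θ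

/-- The uniform interpolation property. -/
def UIP (L : Set Formula) : Prop :=
  ∀ (φ : Formula) (P : Finset ℕ), ∃ θ : Formula,
    θ.vars ⊆ φ.vars \ P ∧ φ.imp θ ∈ L ∧
      ∀ ψ : Formula, ψ.vars ∩ P = ∅ → φ.imp ψ ∈ L → θ.imp ψ ∈ L

/-- The Lyndon interpolation property. -/
def LIP (L : Set Formula) : Prop :=
  ∀ φ ψ : Formula, φ.imp ψ ∈ L → ∃ θ : Formula,
    θ.vpos ⊆ φ.vpos ∩ ψ.vpos ∧ θ.vneg ⊆ φ.vneg ∩ ψ.vneg ∧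
      φ.imp θ ∈ L ∧ θ.imp ψ ∈ L

/-- A Kripke model. -/
structure KripkeModel where
  W : Type
  nonempty : Nonempty W
  rel : W → W → Prop
  val : W → ℕ → Prop

/-- Satisfaction in a Kripke model. -/
def KripkeModel.Sat (M : KripkeModel) : Formula → M.W → Prop
  | .var p, w => M.val w p
  | .bot, _ => False
  | .imp φ ψ, w => M.Sat φ w → M.Sat ψ w
  | .box φ, w => ∀ x, M.rel w x → M.Sat φ x

/-- A (P,Q)-formula: v⁺(φ) ⊆ P and v⁻(φ) ⊆ Q. -/
def PQFormula (P Q : Finset ℕ) (φ : Formula) : Prop := φ.vpos ⊆ P ∧ φ.vneg ⊆ Q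

/-- `F n P Q` is a finite list of (P,Q)-formulas of modal depth ≤ n such that every
(P,Q)-formula of modal depth ≤ n is K-provably equivalent to some member. -/
def IsFamily (F : ℕ → Finset ℕ → Finset ℕ → List Formula) : Prop :=
  ∀ (n : ℕ) (P Q : Finset ℕ),
    (∀ φ ∈ F n P Q, PQFormula P Q φ ∧ φ.depth ≤ n) ∧
    ∀ ψ : Formula, PQFormula P Q ψ → ψ.depth ≤ n →
      ∃ φ ∈ F n P Q, Formula.iff φ ψ ∈ TheoryK

/-- Th_n^{(P,Q)}(w) = {φ ∈ F_n^{(P,Q)} : w ⊩ φ}. -/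
def Th (F : ℕ → Finset ℕ → Finset ℕ → List Formula) (M : KripkeModel)
    (n : ℕ) (P Q : Finset ℕ) (w : M.W) : Set Formula :=
  {φ | φ ∈ F n P Q ∧ M.Sat φ w}

def conjList : List Formula → Formula
  | [] => Formula.top
  | φ :: l => φ.and (conjList l)

open Classical in
/-- C_n^{(P,Q)}(w) = ⋀ Th_n^{(P,Q)}(w). -/
noncomputable def Cfml (F : ℕ → Finset ℕ → Finset ℕ → List Formula) (M : KripkeModel)
    (n : ℕ) (P Q : Finset ℕ) (w : M.W) : Formula :=
  conjList ((F n P Q).filter fun φ => decide (M.Sat φ w))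

/-- Layered (P,Q)-bisimulation between M and M'. -/
def LayeredBisim (P Q : Finset ℕ) (M M' : KripkeModel)
    (Z : M.W → ℕ → M'.W → Prop) : Prop :=
  (∀ w n w', Z w n w' →
    (∀ p ∈ P, M.val w p → M'.val w' p) ∧ (∀ q ∈ Q, ¬M.val w q → ¬M'.val w' q)) ∧
  (∀ w n w', Z w (n + 1) w' → ∀ x, M.rel w x → ∃ x', M'.rel w' x' ∧ Z x n x') ∧
  (∀ w n w', Z w (n + 1) w' → ∀ x', M'.rel w' x' → ∃ x, M.rel w x ∧ Z x n x')

/-- Downward closedness of a layered bisimulation. -/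
def DownClosed (M M' : KripkeModel) (Z : M.W → ℕ → M'.W → Prop) : Prop :=
  ∀ w n w', Z w n w' → ∀ m ≤ n, Z w m w'

/-- A class of Kripke models has ULIP. -/
def ClassULIP (F : ℕ → Finset ℕ → Finset ℕ → List Formula) (Cl : Set KripkeModel) : Prop :=
  ∀ P1 P2 P3 Q1 Q2 Q3 : Finset ℕ,
    Disjoint P1 P2 → Disjoint P1 P3 → Disjoint P2 P3 →
    Disjoint Q1 Q2 → Disjoint Q1 Q3 → Disjoint Q2 Q3 →
    ∀ M : KripkeModel, M ∈ Cl → ∀ M' : KripkeModel, M' ∈ Cl →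
    ∀ w : M.W, ∀ w' : M'.W, ∀ m n : ℕ,
      Th F M n P2 Q2 w ⊆ Th F M' n P2 Q2 w' →
      ∃ Mst : KripkeModel, Mst ∈ Cl ∧ ∃ wst : Mst.W,
        Th F M n (P1 ∪ P2) (Q1 ∪ Q2) w ⊆ Th F Mst n (P1 ∪ P2) (Q1 ∪ Q2) wst ∧
        Th F Mst m (P2 ∪ P3) (Q2 ∪ Q3) wst ⊆ Th F M' m (P2 ∪ P3) (Q2 ∪ Q3) w'

namespace ULGL
open Formula

/-- Boolean valuations respecting falsum and implication. -/
def Bv (v : Formula → Bool) : Prop :=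
  v .bot = false ∧ ∀ ψ θ : Formula, v (ψ.imp θ) = (!v ψ || v θ)

theorem foldr_iff {v : Formula → Bool} (hv : Bv v) (l : List Formula) (β : Formula) :
    v (l.foldr imp β) = true ↔ ((∀ a ∈ l, v a = true) → v β = true) := by
  induction l with
  | nil => simp
  | cons a l ih =>
    simp only [List.foldr_cons, hv.2, Bool.or_eq_true, ih, List.forall_mem_cons]
    cases v a <;> simp

theorem compact (S : Set Formula) (β : Formula)
    (h : ∀ v, Bv v → (∀ a ∈ S, v a = true) → v β = true) :
    ∃ l : List Formula, (∀ a ∈ l, a ∈ S) ∧ Tautology (l.foldr imp β) := by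
  by_contra hcon
  push Not at hcon
  have hc : ∀ a : Formula, ∀ b : Bool, IsClosed {v : Formula → Bool | v a = b} := by
    intro a b
    exact isClosed_eq (continuous_apply a) continuous_const
  have hB : IsClosed {v : Formula → Bool | Bv v ∧ v β = false} := by
    have : {v : Formula → Bool | Bv v ∧ v β = false} =
        ({v | v .bot = false} ∩ ⋂ ψ, ⋂ θ, {v : Formula → Bool | v (imp ψ θ) = (!v ψ || v θ)}) ∩
          {v | v β = false} := by
      ext v; simp [Bv]
    rw [this]
    refine ((hc _ _).inter (isClosed_iInter fun ψ => isClosed_iInter fun θ => ?_)).inter (hc _ _)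
    refine isClosed_eq (continuous_apply _) ?_
    have : Continuous (fun p : Bool × Bool => (!p.1 || p.2)) := continuous_of_discreteTopology
    exact this.comp (g := fun p : Bool × Bool => (!p.1 || p.2)) (f := fun v : Formula → Bool => (v ψ, v θ))
      ((continuous_apply ψ).prodMk (continuous_apply θ))
  have key := hB.isCompact.inter_iInter_nonempty
    (fun a : S => {v : Formula → Bool | v a.1 = true}) (fun a => hc _ _) (by
      intro u
      have h2 := hcon (u.toList.map Subtype.val) (by
        intro a ha
        simp only [List.mem_map] at ha
        obtain ⟨x, _, rfl⟩ := ha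
        exact x.2)
      unfold Tautology at h2
      push Not at h2
      obtain ⟨v, h3, h4, h5⟩ := h2
      have hv : Bv v := ⟨h3, h4⟩
      rw [Ne, foldr_iff hv] at h5
      push Not at h5
      refine ⟨v, ⟨hv, by simpa using h5.2⟩, ?_⟩
      simp only [Set.mem_iInter, Set.mem_ofPred_eq]
      intro i hi
      exact h5.1 _ (List.mem_map.2 ⟨i, by simpa using hi, rfl⟩))
  obtain ⟨v, ⟨hv, hb⟩, hS⟩ := key
  simp only [Set.mem_iInter, Set.mem_ofPred_eq] at hS
  have := h v hv (fun a ha => hS ⟨a, ha⟩)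
  rw [hb] at this
  exact absurd this (by simp)

theorem normGL : IsNormal TheoryGL where
  taut φ h := fun L hL => hL.1.taut φ h
  axK := fun L hL => hL.1.axK
  mp φ ψ h1 h2 := fun L hL => hL.1.mp φ ψ (h1 L hL) (h2 L hL)
  nec φ h := fun L hL => hL.1.nec φ (h L hL)
  subst_mem φ h σ := fun L hL => hL.1.subst_mem φ (h L hL) σ

theorem glK (a b : Formula) : (a.imp b).box.imp (a.box.imp b.box) ∈ TheoryGL := by
  have := normGL.subst_mem _ normGL.axK (fun n => if n = 0 then a else b)
  simpa [Formula.subst] using this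

theorem glLob (a : Formula) : (a.box.imp a).box.imp a.box ∈ TheoryGL := by
  have h : axGL ∈ TheoryGL := fun L hL => hL.2 rfl
  have := normGL.subst_mem _ h (fun _ => a)
  simpa [Formula.subst, axGL] using this

/-- Canonical worlds. -/
def Wd (v : Formula → Bool) : Prop := Bv v ∧ ∀ a ∈ TheoryGL, v a = true

theorem Wd.mp {v} (h : Wd v) {a b : Formula} (h1 : v (a.imp b) = true) (h2 : v a = true) :
    v b = true := by
  rw [h.1.2, h2] at h1; simpa using h1

theorem Wd.k {v} (h : Wd v) {a b : Formula} (h1 : v (a.imp b).box = true) (h2 : v a.box = true) :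
    v b.box = true :=
  h.mp (h.mp (h.2 _ (glK a b)) h1) h2

theorem Wd.lob {v} (h : Wd v) {a : Formula} (h1 : v (a.box.imp a).box = true) :
    v a.box = true :=
  h.mp (h.2 _ (glLob a)) h1

theorem Wd.nec {v} (h : Wd v) {a : Formula} (h1 : a ∈ TheoryGL) : v a.box = true :=
  h.2 _ (normGL.nec _ h1)

theorem Wd.four {v} (h : Wd v) {a : Formula} (h1 : v a.box = true) : v a.box.box = true := by
  have t1 : ((a.and a.box).imp a) ∈ TheoryGL := normGL.taut _ (by
    intro v hb hi
    simp only [Formula.and, Formula.neg, hi, hb]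
    cases v a <;> cases v a.box <;> rfl)
  have t2 : ((a.and a.box).imp a.box) ∈ TheoryGL := normGL.taut _ (by
    intro v hb hi
    simp only [Formula.and, Formula.neg, hi, hb]
    cases v a <;> cases v a.box <;> rfl)
  have t3 := normGL.mp _ _ (glK _ _) (normGL.nec _ t1)
  have t4 : a.imp ((a.and a.box).box.imp (a.and a.box)) ∈ TheoryGL := by
    refine normGL.mp _ _ (normGL.taut _ ?_) t3
    intro v hb hi
    simp only [hi]
    simp only [Formula.and, Formula.neg, hi, hb]
    cases v a <;> cases v a.box <;>
      cases v ((a.imp (a.box.imp bot)).imp bot).box <;> rfl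
  exact h.k (h.nec t2) (h.lob (h.k (h.nec t4) h1))

theorem Wd.foldr {v} (h : Wd v) (l : List Formula) (β : Formula)
    (hl : ∀ a ∈ l, v a.box = true) (h1 : v (l.foldr imp β).box = true) : v β.box = true := by
  induction l with
  | nil => exact h1
  | cons a l ih =>
    simp only [List.forall_mem_cons] at hl
    exact ih hl.2 (h.k h1 hl.1)

theorem Wd.exists_succ {v} (h : Wd v) {χ : Formula} (h1 : v χ.box = false) :
    ∃ u, Wd u ∧ (∀ ψ : Formula, v ψ.box = true → u ψ = true ∧ u ψ.box = true) ∧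
      u χ.box = true ∧ u χ = false := by
  by_contra hcon
  obtain ⟨l, hl, ht⟩ := compact {a | v a.box = true} (χ.box.imp χ) (by
    intro u hu hS
    by_contra hne
    rw [hu.2] at hne
    apply hcon
    refine ⟨u, ⟨hu, fun a ha => hS a (h.nec ha)⟩,
      fun ψ hψ => ⟨hS _ hψ, hS _ (h.four hψ)⟩, ?_, ?_⟩
    · revert hne; cases u χ.box <;> simp
    · revert hne; cases u χ <;> simp)
  have := h.lob (h.foldr l _ hl (h.nec (normGL.taut _ ht)))
  rw [h1] at this
  exact absurd this (by simp)

theorem exists_world {φ : Formula} (h : φ ∉ TheoryGL) : ∃ v, Wd v ∧ v φ = false := by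
  by_contra hcon
  obtain ⟨l, hl, ht⟩ := compact TheoryGL φ (by
    intro u hu hS
    by_contra hne
    exact hcon ⟨u, ⟨hu, hS⟩, by simpa using hne⟩)
  apply h
  replace ht := normGL.taut _ ht
  clear hcon h
  induction l with
  | nil => exact ht
  | cons a l ih =>
    simp only [List.forall_mem_cons] at hl
    exact ih hl.2 (normGL.mp _ _ ht hl.1)

/-- GL-models: transitive and conversely well-founded. -/
def GLm (M : KripkeModel) : Prop :=
  (∀ x y z, M.rel x y → M.rel y z → M.rel x z) ∧ WellFounded (fun x y => M.rel y x)

def Valid (φ : Formula) : Prop := ∀ M : KripkeModel, GLm M → ∀ w : M.W, M.Sat φ w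

theorem sat_subst (M : KripkeModel) (σ : ℕ → Formula) (φ : Formula) (w : M.W) :
    M.Sat (φ.subst σ) w ↔
      KripkeModel.Sat ⟨M.W, M.nonempty, M.rel, fun w p => M.Sat (σ p) w⟩ φ w := by
  induction φ generalizing w with
  | var p => rfl
  | bot => rfl
  | imp a b iha ihb => exact imp_congr (iha w) (ihb w)
  | box a ih => exact forall_congr' fun x => imp_congr Iff.rfl (ih x)

theorem validNormal : IsNormal {φ | Valid φ} where
  taut φ h := by
    intro M _ w
    classical
    have := h (fun ψ => decide (M.Sat ψ w)) (decide_eq_false (fun h => h)) (by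
      intro ψ θ
      by_cases h1 : M.Sat ψ w <;> by_cases h2 : M.Sat θ w <;> simp [KripkeModel.Sat, h1, h2])
    simpa using this
  axK := fun M _ w h1 h2 x hx => h1 x hx (h2 x hx)
  mp φ ψ h1 h2 := fun M hM w => h1 M hM w (h2 M hM w)
  nec φ h := fun M hM w x _ => h M hM x
  subst_mem φ h σ := fun M hM w => (sat_subst M σ φ w).2
    (h ⟨M.W, M.nonempty, M.rel, fun w p => M.Sat (σ p) w⟩ hM w)

theorem sound {φ : Formula} (h : φ ∈ TheoryGL) : Valid φ := by
  refine h {φ | Valid φ} ⟨validNormal, ?_⟩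
  rintro _ rfl
  intro M hM w h1 x hx
  induction x using hM.2.induction with
  | _ x ih => exact h1 x hx (fun y hy => ih y hy (hM.1 _ _ _ hx hy))

theorem sub_refl (φ : Formula) : φ ∈ φ.subfmls := by
  cases φ <;> simp [subfmls]

theorem sub_trans {a b : Formula} (h : a ∈ b.subfmls) : a.subfmls ⊆ b.subfmls := by
  induction b with
  | var p => simp only [subfmls, Finset.mem_singleton] at h; subst h; rfl
  | bot => simp only [subfmls, Finset.mem_singleton] at h; subst h; rfl
  | imp c d ihc ihd =>
    simp only [subfmls, Finset.mem_insert, Finset.mem_union] at h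
    rcases h with rfl | h | h
    · rfl
    · exact (ihc h).trans (by intro x; simp only [subfmls, Finset.mem_insert, Finset.mem_union]; tauto)
    · exact (ihd h).trans (by intro x; simp only [subfmls, Finset.mem_insert, Finset.mem_union]; tauto)
  | box c ihc =>
    simp only [subfmls, Finset.mem_insert] at h
    rcases h with rfl | h
    · rfl
    · exact (ihc h).trans (by intro x; simp only [subfmls, Finset.mem_insert]; tauto)

theorem sub_imp {a b φ : Formula} (h : a.imp b ∈ φ.subfmls) :
    a ∈ φ.subfmls ∧ b ∈ φ.subfmls := by
  have := sub_trans h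
  exact ⟨this (by simp [subfmls, sub_refl]), this (by simp [subfmls, sub_refl])⟩

theorem sub_box {a φ : Formula} (h : a.box ∈ φ.subfmls) : a ∈ φ.subfmls :=
  sub_trans h (by simp [subfmls, sub_refl])

/-- The canonical model filtered through the subformulas of `φ`. -/
def canon (φ : Formula) (v0 : {v // Wd v}) : KripkeModel where
  W := {v // Wd v}
  nonempty := ⟨v0⟩
  rel x y := (∀ χ : Formula, χ.box ∈ φ.subfmls → x.1 χ.box = true →
      y.1 χ = true ∧ y.1 χ.box = true) ∧
    ∃ χ : Formula, χ.box ∈ φ.subfmls ∧ x.1 χ.box = false ∧ y.1 χ.box = true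
  val x p := x.1 (.var p) = true

theorem canon_GLm (φ : Formula) (v0) : GLm (canon φ v0) := by
  constructor
  · rintro x y z ⟨h1, χ, h2, h3, h4⟩ ⟨h5, _⟩
    refine ⟨fun ψ hψ hx => h5 ψ hψ (h1 ψ hψ hx).2, χ, h2, h3, (h5 χ h2 h4).2⟩
  · let f : {v // Wd v} → ℕ := fun v =>
      (φ.subfmls.filter (fun ψ => ψ.box ∈ φ.subfmls ∧ v.1 ψ.box = false)).card
    refine Subrelation.wf (r := InvImage (· < ·) f) ?_ (InvImage.wf f Nat.lt_wfRel.wf)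
    rintro y x ⟨h1, χ, h2, h3, h4⟩
    refine Finset.card_lt_card ?_
    rw [Finset.ssubset_iff_of_subset]
    · refine ⟨χ, ?_, ?_⟩
      · simp [h2, h3, sub_box h2]
      · simp [h4]
    · intro ψ
      simp only [Finset.mem_filter]
      rintro ⟨a, b, c⟩
      refine ⟨a, b, ?_⟩
      by_contra hne
      have := (h1 ψ b (by simpa using hne)).2
      rw [c] at this
      exact absurd this (by simp)

theorem canon_truth (φ : Formula) (v0) (χ : Formula) (h : χ ∈ φ.subfmls) (x : {v // Wd v}) :
    (canon φ v0).Sat χ x ↔ x.1 χ = true := by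
  induction χ generalizing x with
  | var p => rfl
  | bot => simp [KripkeModel.Sat, x.2.1.1]
  | imp a b iha ihb =>
    have := sub_imp h
    simp only [KripkeModel.Sat, iha this.1, ihb this.2, x.2.1.2]
    cases x.1 a <;> simp
  | box a ih =>
    have ha := sub_box h
    constructor
    · intro hs
      by_contra hne
      have hne : x.1 a.box = false := by simpa using hne
      obtain ⟨u, hu, h1, h2, h3⟩ := x.2.exists_succ hne
      have := (ih ha ⟨u, hu⟩).1 (hs ⟨u, hu⟩ ⟨fun ψ _ hψ => h1 ψ hψ, a, h, hne, h2⟩)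
      exact absurd (h3.symm.trans this) (by simp)
    · intro hs y hy
      exact (ih ha y).2 (hy.1 a h hs).1

theorem complete {φ : Formula} (h : Valid φ) : φ ∈ TheoryGL := by
  by_contra hcon
  obtain ⟨v, hv, hf⟩ := exists_world hcon
  have := (canon_truth φ ⟨v, hv⟩ φ (sub_refl φ) ⟨v, hv⟩).1 (h _ (canon_GLm φ ⟨v, hv⟩) ⟨v, hv⟩)
  exact absurd (hf.symm.trans this) (by simp)

/-- Directed layered bisimilarity. -/
def Zb (A B : Finset ℕ) (M M' : KripkeModel) : ℕ → M.W → M'.W → Prop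
  | 0, x, x' => (∀ p ∈ A, M.val x p → M'.val x' p) ∧ (∀ q ∈ B, ¬M.val x q → ¬M'.val x' q)
  | k + 1, x, x' =>
    ((∀ p ∈ A, M.val x p → M'.val x' p) ∧ (∀ q ∈ B, ¬M.val x q → ¬M'.val x' q)) ∧
    (∀ y, M.rel x y → ∃ y', M'.rel x' y' ∧ Zb A B M M' k y y') ∧
    (∀ y', M'.rel x' y' → ∃ y, M.rel x y ∧ Zb A B M M' k y y')

theorem Zb.atoms {A B M M' k x x'} (h : Zb A B M M' k x x') :
    (∀ p ∈ A, M.val x p → M'.val x' p) ∧ (∀ q ∈ B, ¬M.val x q → ¬M'.val x' q) := by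
  cases k with
  | zero => exact h
  | succ k => exact h.1

theorem Zb.down1 {A B M M'} (k) (x x') (h : Zb A B M M' (k + 1) x x') : Zb A B M M' k x x' := by
  induction k generalizing x x' with
  | zero => exact h.1
  | succ k ih =>
    refine ⟨h.1, fun y hy => ?_, fun y' hy' => ?_⟩
    · obtain ⟨y', h1, h2⟩ := h.2.1 y hy
      exact ⟨y', h1, ih _ _ h2⟩
    · obtain ⟨y, h1, h2⟩ := h.2.2 y' hy'
      exact ⟨y, h1, ih _ _ h2⟩

theorem Zb.down {A B M M' k m x x'} (h : Zb A B M M' k x x') (hm : m ≤ k) :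
    Zb A B M M' m x x' := by
  induction k with
  | zero => obtain rfl : m = 0 := by omega
            exact h
  | succ k ih =>
    rcases Nat.lt_or_ge k m with h1 | h1
    · obtain rfl : m = k + 1 := by omega
      exact h
    · exact ih (h.down1) h1

theorem Zb.rfl' (A B M k) (x : M.W) : Zb A B M M k x x := by
  induction k generalizing x with
  | zero => exact ⟨fun _ _ h => h, fun _ _ h => h⟩
  | succ k ih =>
    exact ⟨⟨fun _ _ h => h, fun _ _ h => h⟩, fun y hy => ⟨y, hy, ih y⟩, fun y hy => ⟨y, hy, ih y⟩⟩

def disjList : List Formula → Formula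
  | [] => bot
  | φ :: l => φ.neg.imp (disjList l)

theorem sat_and (M : KripkeModel) (a b : Formula) (w : M.W) :
    M.Sat (a.and b) w ↔ M.Sat a w ∧ M.Sat b w := by
  simp only [Formula.and, Formula.neg, KripkeModel.Sat]; tauto

theorem sat_dia (M : KripkeModel) (a : Formula) (w : M.W) :
    M.Sat a.dia w ↔ ∃ x, M.rel w x ∧ M.Sat a x := by
  simp only [Formula.dia, Formula.neg, KripkeModel.Sat, imp_false]; push Not; rfl

theorem sat_conjList (M : KripkeModel) (l : List Formula) (w : M.W) :
    M.Sat (conjList l) w ↔ ∀ a ∈ l, M.Sat a w := by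
  induction l with
  | nil => simp [conjList, Formula.top, Formula.neg, KripkeModel.Sat]
  | cons a l ih => simp [conjList, sat_and, ih]

theorem sat_disjList (M : KripkeModel) (l : List Formula) (w : M.W) :
    M.Sat (disjList l) w ↔ ∃ a ∈ l, M.Sat a w := by
  induction l with
  | nil => simp [disjList, KripkeModel.Sat]
  | cons a l ih =>
    simp only [disjList, KripkeModel.Sat, Formula.neg, ih, List.mem_cons, exists_eq_or_imp]; tauto

def Good (A B : Finset ℕ) (k : ℕ) (θ : Formula) : Prop := PQFormula A B θ ∧ θ.depth ≤ k

theorem good_and {A B k a b} (ha : Good A B k a) (hb : Good A B k b) : Good A B k (a.and b) := by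
  obtain ⟨⟨h1, h2⟩, h3⟩ := ha
  obtain ⟨⟨h4, h5⟩, h6⟩ := hb
  simp only [vpos, vneg] at *
  simp [Good, PQFormula, Formula.and, Formula.neg, vpos, vneg, vsgn, depth,
    Finset.union_subset_iff, *]

theorem good_conjList {A B k} (l : List Formula) (h : ∀ a ∈ l, Good A B k a) :
    Good A B k (conjList l) := by
  induction l with
  | nil => simp [conjList, Formula.top, Good, PQFormula, Formula.neg, vpos, vneg, vsgn, depth]
  | cons a l ih =>
    simp only [List.forall_mem_cons] at h
    exact good_and h.1 (ih h.2)

theorem good_disjList {A B k} (l : List Formula) (h : ∀ a ∈ l, Good A B k a) :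
    Good A B k (disjList l) := by
  induction l with
  | nil => simp [disjList, Good, PQFormula, vpos, vneg, vsgn, depth]
  | cons a l ih =>
    simp only [List.forall_mem_cons] at h
    obtain ⟨⟨h1, h2⟩, h3⟩ := h.1
    obtain ⟨⟨h4, h5⟩, h6⟩ := ih h.2
    simp only [vpos, vneg] at *
    simp [Good, PQFormula, disjList, Formula.neg, vpos, vneg, vsgn, depth,
      Finset.union_subset_iff, *]

theorem good_box {A B k a} (ha : Good A B k a) : Good A B (k + 1) a.box := by
  obtain ⟨⟨h1, h2⟩, h3⟩ := ha
  simp only [vpos, vneg] at *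
  simp [Good, PQFormula, vpos, vneg, vsgn, depth, *]

theorem good_dia {A B k a} (ha : Good A B k a) : Good A B (k + 1) a.dia := by
  obtain ⟨⟨h1, h2⟩, h3⟩ := ha
  simp only [vpos, vneg] at *
  simp [Good, PQFormula, Formula.dia, Formula.neg, vpos, vneg, vsgn, depth, *]

noncomputable def atF (A' B' : Finset ℕ) : Formula :=
  (conjList (A'.toList.map var)).and (conjList (B'.toList.map (fun q => (var q).neg)))

theorem good_atF {A B A' B' : Finset ℕ} (k) (hA : A' ⊆ A) (hB : B' ⊆ B) :
    Good A B k (atF A' B') := by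
  refine good_and (good_conjList _ ?_) (good_conjList _ ?_)
  · intro a ha
    simp only [List.mem_map, Finset.mem_toList] at ha
    obtain ⟨p, hp, rfl⟩ := ha
    simp [Good, PQFormula, vpos, vneg, vsgn, depth, hA hp]
  · intro a ha
    simp only [List.mem_map, Finset.mem_toList] at ha
    obtain ⟨p, hp, rfl⟩ := ha
    simp [Good, PQFormula, Formula.neg, vpos, vneg, vsgn, depth, hB hp]

theorem sat_atF (M' : KripkeModel) (A' B' : Finset ℕ) (x' : M'.W) :
    M'.Sat (atF A' B') x' ↔ (∀ p ∈ A', M'.val x' p) ∧ (∀ q ∈ B', ¬ M'.val x' q) := by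
  simp [atF, sat_and, sat_conjList, KripkeModel.Sat, Formula.neg]

noncomputable def stF (t : Finset ℕ × Finset ℕ × Finset Formula) : Formula :=
  (atF t.1 t.2.1).and ((conjList (t.2.2.toList.map dia)).and (disjList t.2.2.toList).box)

theorem chars (A B : Finset ℕ) (k : ℕ) : ∃ C : Finset Formula, (∀ c ∈ C, Good A B k c) ∧
    ∀ (M : KripkeModel) (x : M.W), ∃ c ∈ C, ∀ (M' : KripkeModel) (x' : M'.W),
      M'.Sat c x' ↔ Zb A B M M' k x x' := by
  classical
  have hat : ∀ (M : KripkeModel) (x : M.W) (M' : KripkeModel) (x' : M'.W),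
      M'.Sat (atF (A.filter (M.val x)) (B.filter (fun q => ¬ M.val x q))) x' ↔
      (∀ p ∈ A, M.val x p → M'.val x' p) ∧ (∀ q ∈ B, ¬M.val x q → ¬M'.val x' q) := by
    intro M x M' x'
    simp only [sat_atF, Finset.mem_filter, and_imp]
  induction k with
  | zero =>
    refine ⟨(A.powerset ×ˢ B.powerset).image (fun t => atF t.1 t.2), ?_, ?_⟩
    · intro c hc
      simp only [Finset.mem_image, Finset.mem_product, Finset.mem_powerset] at hc
      obtain ⟨t, ⟨h1, h2⟩, rfl⟩ := hc
      exact good_atF _ h1 h2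
    · intro M x
      refine ⟨_, Finset.mem_image_of_mem _ (a := (A.filter (M.val x), B.filter (fun q => ¬ M.val x q)))
        ?_, fun M' x' => hat M x M' x'⟩
      simp [Finset.filter_subset]
  | succ k ih =>
    obtain ⟨C, hC, hch⟩ := ih
    refine ⟨(A.powerset ×ˢ B.powerset ×ˢ C.powerset).image stF, ?_, ?_⟩
    · intro c hc
      simp only [Finset.mem_image, Finset.mem_product, Finset.mem_powerset] at hc
      obtain ⟨t, ⟨h1, h2, h3⟩, rfl⟩ := hc
      refine good_and (good_atF _ h1 h2) (good_and (good_conjList _ ?_)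
        (good_box (good_disjList _ ?_)))
      · intro a ha
        simp only [List.mem_map, Finset.mem_toList] at ha
        obtain ⟨p, hp, rfl⟩ := ha
        exact good_dia (hC _ (h3 hp))
      · intro a ha
        exact hC _ (h3 (by simpa using ha))
    · intro M x
      let S := C.filter (fun c => ∃ y, M.rel x y ∧ ∀ (M' : KripkeModel) (x' : M'.W),
        M'.Sat c x' ↔ Zb A B M M' k y x')
      refine ⟨_, Finset.mem_image_of_mem _
        (a := (A.filter (M.val x), B.filter (fun q => ¬ M.val x q), S)) ?_, fun M' x' => ?_⟩
      · simp [Finset.filter_subset, S]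
      · simp only [stF, sat_and, hat, Zb]
        refine and_congr Iff.rfl (and_congr ?_ ?_)
        · simp only [sat_conjList, List.mem_map, Finset.mem_toList]
          constructor
          · intro h y hy
            obtain ⟨c, hc, hc'⟩ := hch M y
            obtain ⟨y', h1, h2⟩ := (sat_dia _ _ _).1
              (h _ ⟨c, Finset.mem_filter.2 ⟨hc, y, hy, hc'⟩, rfl⟩)
            exact ⟨y', h1, (hc' _ _).1 h2⟩
          · rintro h _ ⟨c, hc, rfl⟩
            obtain ⟨_, y, hy, hc'⟩ := Finset.mem_filter.1 hc
            obtain ⟨y', h1, h2⟩ := h y hy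
            exact (sat_dia _ _ _).2 ⟨y', h1, (hc' _ _).2 h2⟩
        · simp only [KripkeModel.Sat, sat_disjList, Finset.mem_toList]
          refine forall_congr' fun y' => imp_congr Iff.rfl ?_
          constructor
          · rintro ⟨c, hc, hs⟩
            obtain ⟨_, y, hy, hc'⟩ := Finset.mem_filter.1 hc
            exact ⟨y, hy, (hc' _ _).1 hs⟩
          · rintro ⟨y, hy, hz⟩
            obtain ⟨c, hc, hc'⟩ := hch M y
            exact ⟨c, Finset.mem_filter.2 ⟨hc, y, hy, hc'⟩, (hc' _ _).2 hz⟩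

open Classical in
/-- Boxed subformulas of `φ` false at `x`. -/
noncomputable def bs (φ : Formula) (M : KripkeModel) (x : M.W) : Finset Formula :=
  φ.subfmls.filter (fun χ => χ.box ∈ φ.subfmls ∧ ¬ M.Sat χ.box x)

theorem bs_card_le (φ : Formula) (M : KripkeModel) (x : M.W) : (bs φ M x).card ≤ φ.boxCount := by
  refine Finset.card_le_card fun χ h => ?_
  simp only [bs, Finset.mem_filter] at h ⊢
  exact ⟨h.1, h.2.1⟩

theorem mem_bs {φ χ : Formula} {M : KripkeModel} {x : M.W} (h : χ.box ∈ φ.subfmls) :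
    χ ∈ bs φ M x ↔ ¬ M.Sat χ.box x := by
  simp [bs, h, sub_box h]

theorem bs_mono {φ : Formula} {M : KripkeModel} (hM : GLm M) {x y : M.W} (h : M.rel x y) :
    bs φ M y ⊆ bs φ M x := by
  intro χ hχ
  simp only [bs, Finset.mem_filter] at hχ ⊢
  exact ⟨hχ.1, hχ.2.1, fun hs => hχ.2.2 fun z hz => hs z (hM.1 _ _ _ h hz)⟩

/-- The amalgam. -/
def amal (φ ψ : Formula) (A B : Finset ℕ) (M M' : KripkeModel)
    (ne : Nonempty {t : M.W × M'.W // ∃ v v', Zb A B M M' (2 * (bs φ M v).card + 1) v v' ∧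
    (v' = t.2 ∨ M'.rel v' t.2) ∧ bs φ M v = bs φ M t.1 ∧
    Zb A B M M' (2 * (bs φ M t.1).card) t.1 t.2}) : KripkeModel where
  W := {t : M.W × M'.W // ∃ v v', Zb A B M M' (2 * (bs φ M v).card + 1) v v' ∧
    (v' = t.2 ∨ M'.rel v' t.2) ∧ bs φ M v = bs φ M t.1 ∧
    Zb A B M M' (2 * (bs φ M t.1).card) t.1 t.2}
  nonempty := ne
  rel s t := M'.rel s.1.2 t.1.2 ∧ ∀ χ : Formula, χ.box ∈ φ.subfmls → M.Sat χ.box s.1.1 →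
    M.Sat χ t.1.1 ∧ M.Sat χ.box t.1.1
  val s p := (p ∈ φ.vpos ∧ M.val s.1.1 p) ∨ (p ∈ ψ.vneg ∧ M'.val s.1.2 p)

theorem amal_GLm (φ ψ A B M M') (hM' : GLm M') (ne) : GLm (amal φ ψ A B M M' ne) := by
  constructor
  · rintro x y z ⟨h1, h2⟩ ⟨h3, h4⟩
    exact ⟨hM'.1 _ _ _ h1 h3, fun χ hχ hs => h4 χ hχ (h2 χ hχ hs).2⟩
  · refine Subrelation.wf (r := InvImage (fun x y => M'.rel y x)
      (fun s : (amal φ ψ A B M M' ne).W => s.1.2)) ?_ (InvImage.wf _ hM'.2)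
    rintro y x ⟨h1, _⟩
    exact h1

theorem amal_zag {φ ψ A B M M'} (hM : GLm M) (hM' : GLm M') (ne)
    (s : (amal φ ψ A B M M' ne).W) (y' : M'.W) (h : M'.rel s.1.2 y') :
    ∃ t : (amal φ ψ A B M M' ne).W, (amal φ ψ A B M M' ne).rel s t ∧ t.1.2 = y' := by
  obtain ⟨⟨x, x'⟩, hs⟩ := s
  obtain ⟨v, v', h1, h2, h3, h4⟩ := id hs
  simp only at h h1 h2 h3 h4
  have h5 : M'.rel v' y' := by
    rcases h2 with rfl | h2
    · exact h
    · exact hM'.1 _ _ _ h2 h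
  obtain ⟨y, hy, hz⟩ := h1.2.2 y' h5
  have hsub := bs_mono (φ := φ) hM hy
  have hrel : ∀ χ : Formula, χ.box ∈ φ.subfmls → M.Sat χ.box x → M.Sat χ y ∧ M.Sat χ.box y := by
    intro χ hχ hx
    have h6 : M.Sat χ.box v := by
      by_contra hne
      rw [← mem_bs hχ, h3, mem_bs hχ] at hne
      exact hne hx
    exact ⟨h6 y hy, fun z hz => h6 z (hM.1 _ _ _ hy hz)⟩
  rcases eq_or_ne (bs φ M y) (bs φ M v) with he | hne
  · exact ⟨⟨(y, y'), v, v', h1, Or.inr h5, he.symm, by simpa [he] using hz⟩, ⟨h, hrel⟩, rfl⟩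
  · have hlt := Finset.card_lt_card (lt_of_le_of_ne hsub hne)
    exact ⟨⟨(y, y'), y, y', hz.down (by omega), Or.inl rfl, rfl, hz.down (by simp only; omega)⟩,
      ⟨h, hrel⟩, rfl⟩

theorem amal_zig {φ ψ A B M M'} (hM : GLm M) (ne)
    (s : (amal φ ψ A B M M' ne).W) (χ : Formula) (hχ : χ.box ∈ φ.subfmls)
    (h : ¬ M.Sat χ.box s.1.1) :
    ∃ t : (amal φ ψ A B M M' ne).W, (amal φ ψ A B M M' ne).rel s t ∧ ¬ M.Sat χ t.1.1 := by
  obtain ⟨⟨x, x'⟩, hs⟩ := s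
  obtain ⟨v, v', h1, h2, h3, h4⟩ := id hs
  simp only at h h1 h2 h3 h4
  have hex : ∃ y, M.rel x y ∧ ¬ M.Sat χ y := by
    simpa [KripkeModel.Sat] using h
  obtain ⟨y, ⟨hy, hyc⟩, hmin⟩ := hM.2.has_min {y | M.rel x y ∧ ¬ M.Sat χ y} hex
  have hbox : M.Sat χ.box y := by
    intro z hz
    by_contra hne
    exact hmin z ⟨hM.1 _ _ _ hy hz, hne⟩ hz
  have hsub := bs_mono (φ := φ) hM hy
  have hlt : (bs φ M y).card < (bs φ M x).card := by
    refine Finset.card_lt_card (lt_of_le_of_ne hsub ?_)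
    intro he
    have := (mem_bs hχ).2 h
    rw [← he, mem_bs hχ] at this
    exact this hbox
  have h5 : Zb A B M M' ((2 * (bs φ M y).card + 1) + 1) x x' := h4.down (by omega)
  obtain ⟨y', hy', hz⟩ := h5.2.1 y hy
  exact ⟨⟨(y, y'), y, y', hz, Or.inl rfl, rfl, hz.down (by simp only; omega)⟩,
    ⟨hy', fun ξ _ hx => ⟨hx y hy, fun z hz => hx z (hM.1 _ _ _ hy hz)⟩⟩, hyc⟩

theorem amal_left {φ ψ A B M M'} (hM : GLm M) (ne)
    (hB : ∀ p ∈ φ.vneg, p ∈ ψ.vneg → p ∈ B)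
    (χ : Formula) (hχ : χ ∈ φ.subfmls) (s : (amal φ ψ A B M M' ne).W) :
    (χ.vpos ⊆ φ.vpos → χ.vneg ⊆ φ.vneg → M.Sat χ s.1.1 → (amal φ ψ A B M M' ne).Sat χ s) ∧
    (χ.vneg ⊆ φ.vpos → χ.vpos ⊆ φ.vneg → (amal φ ψ A B M M' ne).Sat χ s → M.Sat χ s.1.1) := by
  induction χ generalizing s with
  | var p =>
    simp only [vpos, vneg, vsgn, Finset.singleton_subset_iff]
    refine ⟨fun h1 _ h => Or.inl ⟨h1, h⟩, fun _ h1 h => ?_⟩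
    rcases h with h | h
    · exact h.2
    · obtain ⟨_, _, _, _, _, hz⟩ := s.2
      by_contra hne
      exact hz.atoms.2 p (hB p h1 h.1) hne h.2
  | bot => exact ⟨fun _ _ h => h, fun _ _ h => h⟩
  | imp a b iha ihb =>
    have hs := sub_imp hχ
    have ha := iha hs.1 s
    have hb := ihb hs.2 s
    simp only [vpos, vneg, vsgn, Finset.union_subset_iff, Bool.not_true, Bool.not_false] at ha hb ⊢
    exact ⟨fun h1 h2 h h' => hb.1 h1.2 h2.2 (h (ha.2 h1.1 h2.1 h')),
      fun h1 h2 h h' => hb.2 h1.2 h2.2 (h (ha.1 h1.1 h2.1 h'))⟩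
  | box a ih =>
    have ih := ih (sub_box hχ)
    refine ⟨fun h1 h2 h t ht => (ih t).1 h1 h2 (ht.2 a hχ h).1, fun h1 h2 h => ?_⟩
    by_contra hne
    obtain ⟨t, ht, hf⟩ := amal_zig hM ne s a hχ hne
    exact hf ((ih t).2 h1 h2 (h t ht))

theorem amal_right {φ ψ A B M M'} (hM : GLm M) (hM' : GLm M') (ne)
    (hA : ∀ p ∈ φ.vpos, p ∈ ψ.vpos → p ∈ A)
    (χ : Formula) (s : (amal φ ψ A B M M' ne).W) :
    (χ.vpos ⊆ ψ.vpos → χ.vneg ⊆ ψ.vneg → (amal φ ψ A B M M' ne).Sat χ s → M'.Sat χ s.1.2) ∧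
    (χ.vneg ⊆ ψ.vpos → χ.vpos ⊆ ψ.vneg → M'.Sat χ s.1.2 → (amal φ ψ A B M M' ne).Sat χ s) := by
  induction χ generalizing s with
  | var p =>
    simp only [vpos, vneg, vsgn, Finset.singleton_subset_iff]
    refine ⟨fun h1 _ h => ?_, fun _ h1 h => Or.inr ⟨h1, h⟩⟩
    rcases h with h | h
    · obtain ⟨_, _, _, _, _, hz⟩ := s.2
      exact hz.atoms.1 p (hA p h.1 h1) h.2
    · exact h.2
  | bot => exact ⟨fun _ _ h => h, fun _ _ h => h⟩
  | imp a b iha ihb =>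
    have ha := iha s
    have hb := ihb s
    simp only [vpos, vneg, vsgn, Finset.union_subset_iff, Bool.not_true, Bool.not_false] at ha hb ⊢
    exact ⟨fun h1 h2 h h' => hb.1 h1.2 h2.2 (h (ha.2 h1.1 h2.1 h')),
      fun h1 h2 h h' => hb.2 h1.2 h2.2 (h (ha.1 h1.1 h2.1 h'))⟩
  | box a ih =>
    refine ⟨fun h1 h2 h y' hy' => ?_, fun h1 h2 h t ht => (ih t).2 h1 h2 (h _ ht.1)⟩
    obtain ⟨t, ht, rfl⟩ := amal_zag hM hM' ne s y' hy'
    exact (ih t).1 h1 h2 (h t ht)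

theorem main (φ : Formula) (P Q : Finset ℕ) : ∃ θ : Formula,
    IsULInterpolant TheoryGL φ P Q θ ∧ θ.depth ≤ 2 * φ.boxCount + 1 := by
  classical
  obtain ⟨C, hC, hch⟩ := chars (φ.vpos \ P) (φ.vneg \ Q) (2 * φ.boxCount + 1)
  let D := C.filter (fun c => ∃ (M : KripkeModel) (w : M.W), GLm M ∧ M.Sat φ w ∧
    ∀ (M' : KripkeModel) (x' : M'.W), M'.Sat c x' ↔
      Zb (φ.vpos \ P) (φ.vneg \ Q) M M' (2 * φ.boxCount + 1) w x')
  have hg : Good (φ.vpos \ P) (φ.vneg \ Q) (2 * φ.boxCount + 1) (disjList D.toList) :=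
    good_disjList _ (fun a ha => hC a (Finset.mem_filter.1 (Finset.mem_toList.1 ha)).1)
  refine ⟨disjList D.toList, ⟨hg.1.1, hg.1.2, complete ?_, ?_⟩, hg.2⟩
  · intro M hM w hw
    obtain ⟨c, hc, hc'⟩ := hch M w
    exact (sat_disjList _ _ _).2 ⟨c, by
      rw [Finset.mem_toList]
      exact Finset.mem_filter.2 ⟨hc, M, w, hM, hw, hc'⟩, (hc' M w).2 (Zb.rfl' _ _ _ _ _)⟩
  · intro ψ hP hQ himp
    refine complete ?_
    intro M' hM' w' hw'
    obtain ⟨c, hc, hs⟩ := (sat_disjList _ _ _).1 hw'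
    rw [Finset.mem_toList] at hc
    obtain ⟨_, M, w, hM, hw, hc'⟩ := Finset.mem_filter.1 hc
    have hz := (hc' _ _).1 hs
    have hle := bs_card_le φ M w
    have ne : ∃ v v', Zb (φ.vpos \ P) (φ.vneg \ Q) M M' (2 * (bs φ M v).card + 1) v v' ∧
      (v' = (w, w').2 ∨ M'.rel v' (w, w').2) ∧ bs φ M v = bs φ M (w, w').1 ∧
      Zb (φ.vpos \ P) (φ.vneg \ Q) M M' (2 * (bs φ M (w, w').1).card) (w, w').1 (w, w').2 :=
      ⟨w, w', hz.down (by omega), Or.inl rfl, rfl, hz.down (by simp only; omega)⟩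
    have hl := (amal_left (ψ := ψ) hM ⟨⟨(w, w'), ne⟩⟩ (by
      intro p h1 h2
      refine Finset.mem_sdiff.2 ⟨h1, fun h3 => ?_⟩
      have : p ∈ ψ.vneg ∩ Q := Finset.mem_inter.2 ⟨h2, h3⟩
      simp [hQ] at this) φ (sub_refl φ) ⟨(w, w'), ne⟩).1 subset_rfl subset_rfl hw
    have hr := sound himp _ (amal_GLm φ ψ _ _ M M' hM' _) _ hl
    exact (amal_right (φ := φ) hM hM' ⟨⟨(w, w'), ne⟩⟩ (by
      intro p h1 h2
      refine Finset.mem_sdiff.2 ⟨h1, fun h3 => ?_⟩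
      have : p ∈ ψ.vpos ∩ P := Finset.mem_inter.2 ⟨h2, h3⟩
      simp [hP] at this) ψ ⟨(w, w'), ne⟩).1 subset_rfl subset_rfl hr

end ULGL

/-- GL enjoys ULIP, with interpolants of depth at most 3n(φ)+3. -/
theorem ulip_GL : ULIP TheoryGL ∧
    ∀ (φ : Formula) (P Q : Finset ℕ), ∃ θ : Formula,
      IsULInterpolant TheoryGL φ P Q θ ∧ θ.depth ≤ 3 * φ.boxCount + 3 := by
  refine ⟨fun φ P Q => ?_, fun φ P Q => ?_⟩
  · obtain ⟨θ, h, _⟩ := ULGL.main φ P Q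
    exact ⟨θ, h⟩
  · obtain ⟨θ, h, hd⟩ := ULGL.main φ P Q
    exact ⟨θ, h, by omega⟩
end

section
/- The Grzegorczyk logic Grz enjoys ULIP; moreover, for every formula φ and all finite sets P, Q of propositional variables there exists a uniform Lyndon interpolant θ of (φ,P,Q) in Grz with d(θ) ≤ 3n(φ)+3. -/
namespace GrzULIP

open Formula

/-! ### Basic semantics -/

theorem sat_imp (M : KripkeModel) (a b : Formula) (w : M.W) :
    M.Sat (a.imp b) w ↔ (M.Sat a w → M.Sat b w) := Iff.rfl
theorem sat_bot (M : KripkeModel) (w : M.W) : M.Sat .bot w ↔ False := Iff.rfl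
theorem sat_box (M : KripkeModel) (a : Formula) (w : M.W) :
    M.Sat a.box w ↔ ∀ x, M.rel w x → M.Sat a x := Iff.rfl
theorem sat_neg (M : KripkeModel) (a : Formula) (w : M.W) :
    M.Sat a.neg w ↔ ¬ M.Sat a w := Iff.rfl
theorem sat_and (M : KripkeModel) (a b : Formula) (w : M.W) :
    M.Sat (a.and b) w ↔ (M.Sat a w ∧ M.Sat b w) := by
  simp only [Formula.and, sat_neg, sat_imp]; tauto
theorem sat_dia (M : KripkeModel) (a : Formula) (w : M.W) :
    M.Sat a.dia w ↔ ∃ x, M.rel w x ∧ M.Sat a x := by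
  simp only [Formula.dia, sat_neg, sat_box]; push Not; rfl

theorem sat_conj (M : KripkeModel) (l : List Formula) (w : M.W) :
    M.Sat (conjList l) w ↔ ∀ a ∈ l, M.Sat a w := by
  induction l with
  | nil => simp [conjList, Formula.top, sat_neg, sat_bot]
  | cons a l ih => simp [conjList, sat_and, ih]

def disjList : List Formula → Formula
  | [] => Formula.bot
  | a :: l => a.neg.imp (disjList l)

theorem sat_disj (M : KripkeModel) (l : List Formula) (w : M.W) :
    M.Sat (disjList l) w ↔ ∃ a ∈ l, M.Sat a w := by
  induction l with
  | nil => simp [disjList, sat_bot]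
  | cons a l ih => simp only [disjList, sat_imp, sat_neg, ih, List.mem_cons, exists_eq_or_imp]; tauto

/-- bounded formulas -/
def Bd (P Q : Finset ℕ) (n : ℕ) (a : Formula) : Prop :=
  a.vsgn true ⊆ P ∧ a.vsgn false ⊆ Q ∧ a.depth ≤ n

theorem Bd.neg {P Q n a} (h : Bd Q P n a) : Bd P Q n a.neg := by
  obtain ⟨h1, h2, h3⟩ := h
  refine ⟨?_, ?_, ?_⟩ <;> simp [Formula.neg, vsgn, depth, *]
theorem Bd.imp {P Q n a b} (h : Bd Q P n a) (h' : Bd P Q n b) : Bd P Q n (a.imp b) := by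
  obtain ⟨h1, h2, h3⟩ := h
  obtain ⟨h1', h2', h3'⟩ := h'
  refine ⟨?_, ?_, ?_⟩ <;> simp [vsgn, depth, Finset.union_subset_iff, *]
theorem Bd.and {P Q n a b} (h : Bd P Q n a) (h' : Bd P Q n b) : Bd P Q n (a.and b) :=
  (h.imp h'.neg).neg
theorem Bd.box {P Q n a} (h : Bd P Q n a) : Bd P Q (n+1) a.box := by
  obtain ⟨h1, h2, h3⟩ := h
  refine ⟨?_, ?_, ?_⟩ <;> simp [vsgn, depth, *]
theorem Bd.dia {P Q n a} (h : Bd P Q n a) : Bd P Q (n+1) a.dia := h.neg.box.neg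
theorem Bd.bot {P Q n} : Bd P Q n .bot := by
  refine ⟨?_, ?_, ?_⟩ <;> simp [vsgn, depth]
theorem Bd.conj {P Q n} {l : List Formula} (h : ∀ a ∈ l, Bd P Q n a) :
    Bd P Q n (conjList l) := by
  induction l with
  | nil => exact Bd.bot.neg
  | cons a l ih =>
    exact (h a (by simp)).and (ih fun b hb => h b (by simp [hb]))
theorem Bd.disj {P Q n} {l : List Formula} (h : ∀ a ∈ l, Bd P Q n a) :
    Bd P Q n (disjList l) := by
  induction l with
  | nil => exact Bd.bot
  | cons a l ih =>
    exact (h a (by simp)).neg.imp (ih fun b hb => h b (by simp [hb]))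

/-! ### Layered simulations -/

def At (P Q : Finset ℕ) (M M' : KripkeModel) (w : M.W) (w' : M'.W) : Prop :=
  (∀ p ∈ P, M.val w p → M'.val w' p) ∧ (∀ q ∈ Q, ¬M.val w q → ¬M'.val w' q)

def Z (P Q : Finset ℕ) (M M' : KripkeModel) : ℕ → M.W → M'.W → Prop
  | 0, w, w' => At P Q M M' w w'
  | n+1, w, w' => At P Q M M' w w' ∧
      (∀ x, M.rel w x → ∃ x', M'.rel w' x' ∧ Z P Q M M' n x x') ∧
      (∀ x', M'.rel w' x' → ∃ x, M.rel w x ∧ Z P Q M M' n x x')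

theorem Z.at {P Q M M' n w w'} (h : Z P Q M M' n w w') : At P Q M M' w w' := by
  cases n with
  | zero => exact h
  | succ n => exact h.1

theorem Z.pred {P Q M M' n} : ∀ {w w'}, Z P Q M M' (n+1) w w' → Z P Q M M' n w w' := by
  induction n with
  | zero => intro w w' h; exact h.1
  | succ n ih =>
    intro w w' h
    refine ⟨h.1, fun x hx => ?_, fun x' hx' => ?_⟩
    · obtain ⟨x', h1, h2⟩ := h.2.1 x hx
      exact ⟨x', h1, ih h2⟩
    · obtain ⟨x, h1, h2⟩ := h.2.2 x' hx'
      exact ⟨x, h1, ih h2⟩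

theorem Z.mono {P Q M M' n m w w'} (h : Z P Q M M' n w w') (hm : m ≤ n) :
    Z P Q M M' m w w' := by
  induction n, hm using Nat.le_induction with
  | base => exact h
  | succ n _ ih => exact ih h.pred

theorem Z.rfl' {P Q M n} : ∀ w, Z P Q M M n w w := by
  induction n with
  | zero => intro w; exact ⟨fun _ _ h => h, fun _ _ h => h⟩
  | succ n ih =>
    intro w
    exact ⟨⟨fun _ _ h => h, fun _ _ h => h⟩, fun x hx => ⟨x, hx, ih x⟩, fun x hx => ⟨x, hx, ih x⟩⟩

def Chz (P Q : Finset ℕ) (n : ℕ) (M : KripkeModel) (w : M.W) (c : Formula) : Prop :=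
  ∀ (M' : KripkeModel) (w' : M'.W), M'.Sat c w' ↔ Z P Q M M' n w w'

noncomputable def atF (A B : Finset ℕ) : Formula :=
  (conjList (A.toList.map .var)).and (conjList (B.toList.map fun q => (Formula.var q).neg))

theorem atF_bd {P Q A B : Finset ℕ} (hA : A ⊆ P) (hB : B ⊆ Q) (n : ℕ) : Bd P Q n (atF A B) := by
  refine Bd.and (Bd.conj ?_) (Bd.conj ?_)
  · intro a ha
    simp only [List.mem_map, Finset.mem_toList] at ha
    obtain ⟨p, hp, rfl⟩ := ha
    exact ⟨by simpa [vsgn] using hA hp, by simp [vsgn], by simp [depth]⟩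
  · intro a ha
    simp only [List.mem_map, Finset.mem_toList] at ha
    obtain ⟨p, hp, rfl⟩ := ha
    exact Bd.neg ⟨by simpa [vsgn] using hB hp, by simp [vsgn], by simp [depth]⟩

theorem sat_atF (A B : Finset ℕ) (M : KripkeModel) (w : M.W) :
    M.Sat (atF A B) w ↔ (∀ p ∈ A, M.val w p) ∧ (∀ q ∈ B, ¬ M.val w q) := by
  simp [atF, sat_and, sat_conj, sat_neg, KripkeModel.Sat]

open Classical in
theorem exists_atF (P Q : Finset ℕ) (M : KripkeModel) (w : M.W) :
    ∃ A ∈ P.powerset, ∃ B ∈ Q.powerset, ∀ (M' : KripkeModel) (w' : M'.W),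
      M'.Sat (atF A B) w' ↔ At P Q M M' w w' := by
  refine ⟨P.filter fun p => M.val w p, by simp, Q.filter fun q => ¬ M.val w q, by simp, ?_⟩
  intro M' w'
  simp only [sat_atF, Finset.mem_filter, At, and_imp]

open Classical in
theorem exists_char (P Q : Finset ℕ) (n : ℕ) :
    ∃ L : Finset Formula, (∀ c ∈ L, Bd P Q n c) ∧
      ∀ (M : KripkeModel) (w : M.W), ∃ c ∈ L, Chz P Q n M w c := by
  induction n with
  | zero =>
    refine ⟨(P.powerset ×ˢ Q.powerset).image fun x => atF x.1 x.2, ?_, ?_⟩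
    · intro c hc
      simp only [Finset.mem_image, Finset.mem_product, Finset.mem_powerset] at hc
      obtain ⟨x, ⟨h1, h2⟩, rfl⟩ := hc
      exact atF_bd h1 h2 0
    · intro M w
      obtain ⟨A, hA, B, hB, h⟩ := exists_atF P Q M w
      exact ⟨atF A B, Finset.mem_image.2 ⟨(A, B), by simp_all, rfl⟩, h⟩
  | succ n ih =>
    obtain ⟨L, hL, hC⟩ := ih
    refine ⟨(P.powerset ×ˢ Q.powerset ×ˢ L.powerset).image fun x => (atF x.1 x.2.1).and
      ((conjList (x.2.2.toList.map Formula.dia)).and (disjList x.2.2.toList).box), ?_, ?_⟩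
    · intro c hc
      simp only [Finset.mem_image, Finset.mem_product, Finset.mem_powerset] at hc
      obtain ⟨⟨A, B, S⟩, ⟨h1, h2, h3⟩, rfl⟩ := hc
      refine (atF_bd h1 h2 _).and (Bd.and (Bd.conj ?_) (Bd.box (Bd.disj ?_)))
      · intro a ha
        simp only [List.mem_map, Finset.mem_toList] at ha
        obtain ⟨b, hb, rfl⟩ := ha
        exact (hL b (h3 hb)).dia
      · intro a ha
        exact hL a (h3 (Finset.mem_toList.1 ha))
    · intro M w
      obtain ⟨A, hA, B, hB, h⟩ := exists_atF P Q M w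
      let S := L.filter fun c => ∃ x, M.rel w x ∧ Chz P Q n M x c
      refine ⟨_, Finset.mem_image.2 ⟨(A, B, S), ?_, rfl⟩, ?_⟩
      · simp only [Finset.mem_product]
        exact ⟨hA, hB, by simp [S]⟩
      · intro M' w'
        simp only [sat_and, h, sat_conj, sat_box, sat_disj, List.mem_map, Finset.mem_toList, Z]
        refine and_congr_right fun _ => and_congr ?_ ?_
        · constructor
          · intro H x hx
            obtain ⟨c, hc, hcx⟩ := hC M x
            obtain ⟨x', h1, h2⟩ := (sat_dia _ _ _).1
              (H _ ⟨c, Finset.mem_filter.2 ⟨hc, x, hx, hcx⟩, rfl⟩)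
            exact ⟨x', h1, (hcx _ _).1 h2⟩
          · rintro H _ ⟨c, hc, rfl⟩
            obtain ⟨_, x, hx, hcx⟩ := Finset.mem_filter.1 hc
            obtain ⟨x', h1, h2⟩ := H x hx
            exact (sat_dia _ _ _).2 ⟨x', h1, (hcx _ _).2 h2⟩
        · refine forall_congr' fun x' => forall_congr' fun hx' => ?_
          constructor
          · rintro ⟨c, hc, hs⟩
            obtain ⟨_, x, hx, hcx⟩ := Finset.mem_filter.1 hc
            exact ⟨x, hx, (hcx _ _).1 hs⟩
          · rintro ⟨x, hx, hz⟩
            obtain ⟨c, hc, hcx⟩ := hC M x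
            exact ⟨c, Finset.mem_filter.2 ⟨hc, x, hx, hcx⟩, (hcx _ _).2 hz⟩

/-! ### Grz models and soundness -/

structure IsGrz (M : KripkeModel) : Prop where
  refl : ∀ x, M.rel x x
  trans : ∀ x y z, M.rel x y → M.rel y z → M.rel x z
  antisymm : ∀ x y, M.rel x y → M.rel y x → x = y
  wf : WellFounded fun a b : M.W => M.rel b a ∧ a ≠ b

theorem IsGrz.exists_max {M : KripkeModel} (h : IsGrz M) (p : M.W → Prop) {w : M.W} (hw : p w) :
    ∃ u, M.rel w u ∧ p u ∧ ∀ z, M.rel u z → p z → z = u := by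
  obtain ⟨u, ⟨h1, h2⟩, h3⟩ := h.wf.has_min {u | M.rel w u ∧ p u} ⟨w, h.refl w, hw⟩
  refine ⟨u, h1, h2, fun z hz hpz => ?_⟩
  by_contra hne
  exact h3 z ⟨h.trans _ _ _ h1 hz, hpz⟩ ⟨hz, hne⟩

theorem sat_subst (M : KripkeModel) (σ : ℕ → Formula) (φ : Formula) (w : M.W) :
    M.Sat (subst σ φ) w ↔
      KripkeModel.Sat ⟨M.W, M.nonempty, M.rel, fun w p => M.Sat (σ p) w⟩ φ w := by
  induction φ generalizing w with
  | var p => exact Iff.rfl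
  | bot => exact Iff.rfl
  | imp a b iha ihb => exact imp_congr (iha w) (ihb w)
  | box a ih => exact forall_congr' fun x => imp_congr Iff.rfl (ih x)

open Classical in
theorem sat_taut (M : KripkeModel) (w : M.W) (φ : Formula) (h : Tautology φ) : M.Sat φ w := by
  have := h (fun ψ => decide (M.Sat ψ w)) (decide_eq_false (fun h => h))
    (fun ψ θ => by
      by_cases h1 : M.Sat ψ w <;> by_cases h2 : M.Sat θ w <;> simp [sat_imp, h1, h2])
  simpa using this

theorem grz_valid {M : KripkeModel} (h : IsGrz M) (w : M.W) : M.Sat axGrz w := by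
  intro H
  by_contra hw
  obtain ⟨u, h1, h2, h3⟩ := h.exists_max (fun u => ¬ M.Sat (.var 0) u) hw
  refine h2 (H u h1 ?_)
  intro z hz hpz t ht
  by_contra hpt
  have e := h3 t (h.trans _ _ _ hz ht) hpt
  subst e
  have := h.antisymm _ _ hz ht
  subst this
  exact hpt hpz

theorem sound {φ : Formula} (hφ : φ ∈ TheoryGrz) {M : KripkeModel} (h : IsGrz M) (w : M.W) :
    M.Sat φ w := by
  have : φ ∈ {φ | ∀ M : KripkeModel, IsGrz M → ∀ w, M.Sat φ w} := by
    refine hφ _ ⟨?_, ?_⟩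
    · constructor
      · intro φ h M _ w; exact sat_taut M w φ h
      · intro M _ w h1 h2 x hx; exact h1 x hx (h2 x hx)
      · intro φ ψ h1 h2 M hM w; exact h1 M hM w (h2 M hM w)
      · intro φ h M hM w x _; exact h M hM x
      · intro φ h σ M hM w
        rw [sat_subst]
        exact h ⟨M.W, M.nonempty, M.rel, fun w p => M.Sat (σ p) w⟩
          ⟨hM.refl, hM.trans, hM.antisymm, hM.wf⟩ w
    · rintro _ rfl M hM w
      exact grz_valid hM w
  exact this M h w

/-! ### Completeness -/

theorem grz_normal : IsNormal TheoryGrz := by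
  constructor
  · intro φ h L hL; exact hL.1.taut φ h
  · intro L hL; exact hL.1.axK
  · intro φ ψ h1 h2 L hL; exact hL.1.mp φ ψ (h1 L hL) (h2 L hL)
  · intro φ h L hL; exact hL.1.nec φ (h L hL)
  · intro φ h σ L hL; exact hL.1.subst_mem φ (h L hL) σ

theorem grz_ax : axGrz ∈ TheoryGrz := fun _ hL => hL.2 rfl

theorem grz_inst (a : Formula) :
    ((a.imp a.box).box.imp a).box.imp a ∈ TheoryGrz :=
  grz_normal.subst_mem _ grz_ax (fun _ => a)

theorem k_inst (a b : Formula) : (a.imp b).box.imp (a.box.imp b.box) ∈ TheoryGrz := by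
  have := grz_normal.subst_mem _ grz_normal.axK (fun n => if n = 0 then a else b)
  simpa [subst] using this

def IsVal (v : Formula → Bool) : Prop :=
  v .bot = false ∧ ∀ ψ θ : Formula, v (ψ.imp θ) = (!v ψ || v θ)

def imps (l : List Formula) (φ : Formula) : Formula := l.foldr .imp φ

theorem val_imps {v} (h : IsVal v) (l : List Formula) (φ : Formula) :
    v (imps l φ) = true ↔ ((∀ a ∈ l, v a = true) → v φ = true) := by
  induction l with
  | nil => simp [imps]
  | cons a l ih =>
    have : imps (a :: l) φ = a.imp (imps l φ) := rfl
    rw [this, h.2]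
    simp only [Bool.or_eq_true, ih, List.mem_cons, forall_eq_or_imp]
    cases v a <;> simp

theorem isClosed_eval (a : Formula) (b : Bool) : IsClosed {v : Formula → Bool | v a = b} :=
  isClosed_eq (continuous_apply a) continuous_const

theorem isClosed_val : IsClosed {v : Formula → Bool | IsVal v} := by
  have : {v : Formula → Bool | IsVal v} = {v | v .bot = false} ∩
      ⋂ ψ : Formula, ⋂ θ : Formula, {v : Formula → Bool | v (ψ.imp θ) = (!v ψ || v θ)} := by
    ext v; simp [IsVal]
  rw [this]
  refine (isClosed_eval _ _).inter (isClosed_iInter fun ψ => isClosed_iInter fun θ => ?_)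
  refine isClosed_eq (continuous_apply _) ?_
  have : Continuous fun p : Bool × Bool => (!p.1 || p.2) := continuous_of_discreteTopology
  exact this.comp (f := fun v : Formula → Bool => (v ψ, v θ))
    ((continuous_apply ψ).prodMk (continuous_apply θ))

theorem compactness (Γ : Set Formula) (φ : Formula)
    (h : ∀ v, IsVal v → (∀ a ∈ Γ, v a = true) → v φ = true) :
    ∃ l : List Formula, (∀ a ∈ l, a ∈ Γ) ∧ Tautology (imps l φ) := by
  have hc : IsCompact ({v : Formula → Bool | IsVal v} ∩ {v | v φ = false}) :=
    (isClosed_val.inter (isClosed_eval _ _)).isCompact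
  obtain ⟨u, hu⟩ := hc.elim_finite_subfamily_closed
    (fun a : Γ => {v : Formula → Bool | v a.1 = true}) (fun a => isClosed_eval _ _) (by
      ext v
      simp only [Set.mem_inter_iff, Set.mem_ofPred_eq, Set.mem_iInter, Set.mem_empty_iff_false,
        iff_false, not_and]
      rintro ⟨h1, h2⟩ h3
      have := h v h1 (fun a ha => h3 ⟨a, ha⟩)
      simp [this] at h2)
  refine ⟨u.toList.map (·.1), ?_, ?_⟩
  · intro a ha
    simp only [List.mem_map] at ha
    obtain ⟨b, _, rfl⟩ := ha
    exact b.2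
  · intro v hv1 hv2
    rw [val_imps ⟨hv1, hv2⟩]
    intro H
    by_contra hf
    have : v ∈ (∅ : Set (Formula → Bool)) := by
      rw [← hu]
      refine ⟨⟨⟨hv1, hv2⟩, by simpa using hf⟩, ?_⟩
      simp only [Set.mem_iInter]
      intro a ha
      exact H a.1 (List.mem_map.2 ⟨a, Finset.mem_toList.2 ha, rfl⟩)
    exact this

theorem mp_imps {l : List Formula} {φ : Formula} (h : imps l φ ∈ TheoryGrz)
    (hl : ∀ a ∈ l, a ∈ TheoryGrz) : φ ∈ TheoryGrz := by
  induction l with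
  | nil => exact h
  | cons a l ih =>
    exact ih (grz_normal.mp _ _ h (hl a (by simp))) fun b hb => hl b (by simp [hb])

def CW : Type := {v : Formula → Bool // IsVal v ∧ ∀ a ∈ TheoryGrz, v a = true}

theorem exists_cw {φ : Formula} (h : φ ∉ TheoryGrz) : ∃ v : CW, v.1 φ = false := by
  by_contra hne
  push Not at hne
  obtain ⟨l, hl, ht⟩ := compactness TheoryGrz φ (fun v hv hL => by
    simpa using hne ⟨v, hv, hL⟩)
  exact h (mp_imps (grz_normal.taut _ ht) hl)

theorem cw_box_imps (v : CW) (l : List Formula) (φ : Formula) (h : v.1 (imps l φ).box = true)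
    (hl : ∀ a ∈ l, v.1 a.box = true) : v.1 φ.box = true := by
  induction l with
  | nil => exact h
  | cons a l ih =>
    refine ih ?_ fun b hb => hl b (by simp [hb])
    have h1 := v.2.2 _ (k_inst a (imps l φ))
    have h2 : v.1 (a.imp (imps l φ)).box = true := h
    rw [v.2.1.2, v.2.1.2, h2, hl a (by simp)] at h1
    simpa using h1

def cRel (v u : CW) : Prop := ∀ a, v.1 a.box = true → u.1 a = true

theorem cw_exists (v : CW) (φ : Formula) (h : v.1 φ.box = false) :
    ∃ u : CW, cRel v u ∧ u.1 φ = false := by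
  by_contra hne
  push Not at hne
  obtain ⟨l, hl, ht⟩ := compactness {a | v.1 a.box = true} φ (fun u hu hL => by
    have hL' : ∀ a ∈ TheoryGrz, u a = true :=
      fun a ha => hL a (v.2.2 _ (grz_normal.nec a ha))
    simpa using hne ⟨u, hu, hL'⟩ hL)
  have := cw_box_imps v l φ (v.2.2 _ (grz_normal.nec _ (grz_normal.taut _ ht))) hl
  simp [this] at h

def canon (v : CW) : KripkeModel := ⟨CW, ⟨v⟩, cRel, fun w p => w.1 (.var p) = true⟩

theorem canon_sat (v0 : CW) (φ : Formula) (v : CW) :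
    (canon v0).Sat φ v ↔ v.1 φ = true := by
  induction φ generalizing v with
  | var p => exact Iff.rfl
  | bot => exact ⟨fun h => h.elim, fun h => by simp [v.2.1.1] at h⟩
  | imp a b iha ihb =>
    refine (imp_congr (iha v) (ihb v)).trans ?_
    rw [v.2.1.2]
    cases v.1 a <;> simp
  | box a ih =>
    constructor
    · intro h
      by_contra hf
      obtain ⟨u, h1, h2⟩ := cw_exists v a (by simpa using hf)
      have := (ih u).1 (h u h1)
      simp [this] at h2
    · intro h u hu
      exact (ih u).2 (hu a h)

theorem sat_T (M : KripkeModel)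
    (G : ∀ (a : Formula) w, M.Sat (((a.imp a.box).box.imp a).box.imp a) w) (a : Formula) (w : M.W)
    (h : M.Sat a.box w) : M.Sat a w :=
  G a w fun x hx _ => h x hx

theorem sat_4 (M : KripkeModel)
    (G : ∀ (a : Formula) w, M.Sat (((a.imp a.box).box.imp a).box.imp a) w) (p : Formula) (w : M.W)
    (h : M.Sat p.box w) : M.Sat p.box.box w := by
  have := G (p.and (p.box.imp p.box.box)) w (by
    intro y hy hq
    rw [sat_and]
    refine ⟨h y hy, fun hpy z hz => ?_⟩
    by_contra hn
    have h1 := hq z hz ((sat_and _ _ _ _).2 ⟨hpy z hz, fun h => absurd h hn⟩)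
    exact hn fun t ht => ((sat_and _ _ _ _).1 (h1 t ht)).1)
  exact ((sat_and _ _ _ _).1 this).2 h

theorem mem_sub_self (φ : Formula) : φ ∈ subfmls φ := by
  cases φ <;> simp [subfmls]

theorem sub_trans {φ ψ : Formula} (h : ψ ∈ subfmls φ) : subfmls ψ ⊆ subfmls φ := by
  induction φ with
  | var p => simp only [subfmls, Finset.mem_singleton] at h; subst h; rfl
  | bot => simp only [subfmls, Finset.mem_singleton] at h; subst h; rfl
  | imp a b iha ihb =>
    simp only [subfmls, Finset.mem_insert, Finset.mem_union] at h
    rcases h with rfl | h | h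
    · rfl
    · intro x hx; simp [subfmls, iha h hx]
    · intro x hx; simp [subfmls, ihb h hx]
  | box a ih =>
    simp only [subfmls, Finset.mem_insert] at h
    rcases h with rfl | h
    · rfl
    · intro x hx; simp [subfmls, ih h hx]

theorem sub_imp {φ a b : Formula} (h : a.imp b ∈ subfmls φ) : a ∈ subfmls φ ∧ b ∈ subfmls φ := by
  have := sub_trans h
  exact ⟨this (by simp [subfmls, mem_sub_self]), this (by simp [subfmls, mem_sub_self])⟩

theorem sub_box {φ a : Formula} (h : a.box ∈ subfmls φ) : a ∈ subfmls φ :=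
  sub_trans h (by simp [subfmls, mem_sub_self])

def bx (φ : Formula) : Finset Formula := (subfmls φ).filter fun ψ => Formula.box ψ ∈ subfmls φ

theorem mem_bx {φ a : Formula} (h : a.box ∈ subfmls φ) : a ∈ bx φ :=
  Finset.mem_filter.2 ⟨sub_box h, h⟩

open Classical in
noncomputable def cb (φ : Formula) (M : KripkeModel) (w : M.W) : ℕ :=
  ((bx φ).filter fun ψ => ¬ M.Sat (ψ.imp ψ.box).box w).card

theorem complete {φ : Formula} (h : ∀ M : KripkeModel, IsGrz M → ∀ w, M.Sat φ w) :
    φ ∈ TheoryGrz := by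
  classical
  by_contra hφ
  obtain ⟨v0, hv0⟩ := exists_cw hφ
  let M := canon v0
  have G : ∀ (a : Formula) (w : M.W), M.Sat (((a.imp a.box).box.imp a).box.imp a) w :=
    fun a w => (canon_sat v0 _ w).2 (w.2.2 _ (grz_inst a))
  have hr : ∀ x, M.rel x x := fun x a hx =>
    (canon_sat v0 _ _).1 (sat_T M G a x ((canon_sat v0 _ _).2 hx))
  have ht : ∀ x y z, M.rel x y → M.rel y z → M.rel x z := fun x y z h1 h2 a hx => by
    refine h2 a (h1 a.box ?_)
    exact (canon_sat v0 _ _).1 (sat_4 M G a x ((canon_sat v0 _ _).2 hx))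
  let N : KripkeModel := ⟨M.W, M.nonempty,
    fun x y => x = y ∨ (M.rel x y ∧ cb φ M y < cb φ M x), M.val⟩
  have hN : IsGrz N := by
    refine ⟨fun x => Or.inl rfl, ?_, ?_, ?_⟩
    · rintro x y z (rfl | ⟨h1, h2⟩) (rfl | ⟨h3, h4⟩)
      · exact Or.inl rfl
      · exact Or.inr ⟨h3, h4⟩
      · exact Or.inr ⟨h1, h2⟩
      · exact Or.inr ⟨ht _ _ _ h1 h3, h4.trans h2⟩
    · rintro x y (rfl | ⟨h1, h2⟩) (h | ⟨h3, h4⟩)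
      · rfl
      · rfl
      · exact h.symm
      · omega
    · refine Subrelation.wf (r := InvImage (· < ·) (cb φ M)) ?_ (InvImage.wf _ wellFounded_lt)
      rintro a b ⟨rfl | ⟨_, h2⟩, hne⟩
      · exact absurd rfl hne
      · exact h2
  have truth : ∀ ψ ∈ subfmls φ, ∀ w : M.W, N.Sat ψ w ↔ M.Sat ψ w := by
    intro ψ
    induction ψ with
    | var p => intro _ w; exact Iff.rfl
    | bot => intro _ w; exact Iff.rfl
    | imp a b iha ihb =>
      intro hs w
      exact imp_congr (iha (sub_imp hs).1 w) (ihb (sub_imp hs).2 w)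
    | box a ih =>
      intro hs w
      have ih := ih (sub_box hs)
      constructor
      · intro hw
        by_contra hn
        have ha : M.Sat a w := (ih w).1 (hw w (Or.inl rfl))
        rw [sat_box] at hn
        push Not at hn
        obtain ⟨x, hx, hxa⟩ := hn
        have hnot : ¬ M.Sat (((a.imp a.box).box.imp a).box) x := fun H => hxa (G a x H)
        rw [sat_box] at hnot
        push Not at hnot
        obtain ⟨u, hu, hua⟩ := hnot
        rw [sat_imp] at hua
        push Not at hua
        obtain ⟨hu1, hu2⟩ := hua
        have hwu := ht _ _ _ hx hu
        refine hu2 ((ih u).1 (hw u (Or.inr ⟨hwu, ?_⟩)))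
        refine Finset.card_lt_card (Finset.ssubset_iff_of_subset ?_ |>.2 ⟨a, ?_, ?_⟩)
        · intro c hc
          rw [Finset.mem_filter] at hc ⊢
          exact ⟨hc.1, fun H => hc.2 fun t hut => H t (ht _ _ _ hwu hut)⟩
        · rw [Finset.mem_filter]
          exact ⟨mem_bx hs, fun H => hxa (H w (hr w) ha x hx)⟩
        · rw [Finset.mem_filter]
          exact fun H => H.2 hu1
      · rintro hw x (rfl | ⟨hx, _⟩)
        · exact (ih w).2 (hw w (hr w))
        · exact (ih x).2 (hw x hx)
  have h1 := (canon_sat v0 _ _).1 ((truth φ (mem_sub_self φ) v0).1 (h N hN v0))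
  simp [h1] at hv0

/-! ### Amalgamation -/

open Classical in
noncomputable def ca (φ : Formula) (M : KripkeModel) (w : M.W) : ℕ :=
  ((bx φ).filter fun ψ => ¬ M.Sat ψ.box w).card

open Classical in
noncomputable def cs (φ : Formula) (M : KripkeModel) (w : M.W) : ℕ :=
  ((bx φ).filter fun ψ => ∃ z, M.rel w z ∧ z ≠ w ∧ ¬ M.Sat ψ z).card

noncomputable def rk (φ : Formula) (M : KripkeModel) (w : M.W) : ℕ :=
  ca φ M w + 2 * cs φ M w + 1

theorem rk_le (φ : Formula) (M : KripkeModel) (w : M.W) : rk φ M w ≤ 3 * φ.boxCount + 1 := by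
  classical
  have h1 : ca φ M w ≤ φ.boxCount := Finset.card_filter_le _ _
  have h2 : cs φ M w ≤ φ.boxCount := Finset.card_filter_le _ _
  unfold rk; omega

section
variable {φ : Formula} {M : KripkeModel} (hM : IsGrz M)
include hM

theorem ca_sub {x y : M.W} (h : M.rel x y) (ψ : Formula) (hx : M.Sat ψ.box x) : M.Sat ψ.box y :=
  fun z hz => hx z (hM.trans _ _ _ h hz)

theorem ca_mono {x y : M.W} (h : M.rel x y) : ca φ M y ≤ ca φ M x := by
  classical
  refine Finset.card_le_card fun c hc => ?_
  rw [Finset.mem_filter] at hc ⊢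
  exact ⟨hc.1, fun H => hc.2 (ca_sub hM h c H)⟩

theorem cs_sub {x y z : M.W} (h : M.rel x y) (hz : M.rel y z) (hne : z ≠ y) :
    M.rel x z ∧ z ≠ x := by
  refine ⟨hM.trans _ _ _ h hz, ?_⟩
  rintro rfl
  exact hne (hM.antisymm _ _ h hz)

theorem cs_mono {x y : M.W} (h : M.rel x y) : cs φ M y ≤ cs φ M x := by
  classical
  refine Finset.card_le_card fun c hc => ?_
  rw [Finset.mem_filter] at hc ⊢
  obtain ⟨h1, z, h2, h3, h4⟩ := hc
  exact ⟨h1, z, (cs_sub hM h h2 h3).1, (cs_sub hM h h2 h3).2, h4⟩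

theorem rk_mono {x y : M.W} (h : M.rel x y) : rk φ M y ≤ rk φ M x := by
  have := ca_mono (φ := φ) hM h
  have := cs_mono (φ := φ) hM h
  unfold rk; omega

theorem rk_eq {x y : M.W} (h : M.rel x y) (he : rk φ M y = rk φ M x) {ψ : Formula}
    (hs : ψ.box ∈ subfmls φ) (hy : M.Sat ψ.box y) : M.Sat ψ.box x := by
  classical
  have h1 := ca_mono (φ := φ) hM h
  have h2 := cs_mono (φ := φ) hM h
  have h3 : ca φ M y = ca φ M x := by unfold rk at he; omega
  by_contra hx
  have : ca φ M y < ca φ M x := by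
    refine Finset.card_lt_card (Finset.ssubset_iff_of_subset ?_ |>.2 ⟨ψ, ?_, ?_⟩)
    · intro c hc
      rw [Finset.mem_filter] at hc ⊢
      exact ⟨hc.1, fun H => hc.2 (ca_sub hM h c H)⟩
    · exact Finset.mem_filter.2 ⟨mem_bx hs, hx⟩
    · rw [Finset.mem_filter]; exact fun H => H.2 hy
  omega

theorem rk_wit {y : M.W} {ψ : Formula} (hs : ψ.box ∈ subfmls φ) (hy : M.Sat ψ y)
    (hb : ¬ M.Sat ψ.box y) : ∃ u, M.rel y u ∧ ¬ M.Sat ψ u ∧ rk φ M u + 2 ≤ rk φ M y := by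
  classical
  rw [sat_box] at hb
  push Not at hb
  obtain ⟨x, hx, hxψ⟩ := hb
  obtain ⟨u, h1, h2, h3⟩ := hM.exists_max (fun u => ¬ M.Sat ψ u) hxψ
  have hyu := hM.trans _ _ _ hx h1
  refine ⟨u, hyu, h2, ?_⟩
  have ha := ca_mono (φ := φ) hM hyu
  have : cs φ M u < cs φ M y := by
    refine Finset.card_lt_card (Finset.ssubset_iff_of_subset ?_ |>.2 ⟨ψ, ?_, ?_⟩)
    · intro c hc
      rw [Finset.mem_filter] at hc ⊢
      obtain ⟨h1, z, h2, h3, h4⟩ := hc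
      exact ⟨h1, z, (cs_sub hM hyu h2 h3).1, (cs_sub hM hyu h2 h3).2, h4⟩
    · refine Finset.mem_filter.2 ⟨mem_bx hs, u, hyu, ?_, h2⟩
      rintro rfl; exact h2 hy
    · rw [Finset.mem_filter]
      rintro ⟨_, z, hz1, hz2, hz3⟩
      exact hz2 (h3 z hz1 hz3)
  unfold rk; omega

end

structure Pt (φ : Formula) (P Q : Finset ℕ) (M M' : KripkeModel) where
  x : M.W
  x' : M'.W
  y : M.W
  y' : M'.W
  hx : M.rel x y
  hx' : M'.rel x' y'
  hZ : Z (φ.vpos \ P) (φ.vneg \ Q) M M' (rk φ M x) x x'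
  hZ' : Z (φ.vpos \ P) (φ.vneg \ Q) M M' (rk φ M x - 1) y y'
  hr : rk φ M y = rk φ M x

def Pt.rel {φ P Q M M'} (s t : Pt φ P Q M M') : Prop :=
  s = t ∨ (s.x = t.x ∧ s.x' = t.x' ∧ M'.rel s.y' t.y' ∧ t.y' ≠ s.y') ∨
    (rk φ M t.x < rk φ M s.x ∧ M.rel s.x t.x ∧ M'.rel s.y' t.x')

def Pt.mk1 {φ P Q M M'} (hM : IsGrz M) (hM' : IsGrz M') (x : M.W) (x' : M'.W)
    (h : Z (φ.vpos \ P) (φ.vneg \ Q) M M' (rk φ M x) x x') : Pt φ P Q M M' :=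
  ⟨x, x', x, x', hM.refl x, hM'.refl x', h, h.mono (Nat.sub_le _ _), rfl⟩

def amal {φ P Q M M'} (s : Pt φ P Q M M') : KripkeModel :=
  ⟨Pt φ P Q M M', ⟨s⟩, Pt.rel, fun s p => (p ∈ φ.vpos ∧ M.val s.y p) ∨ (p ∉ Q ∧ M'.val s.y' p)⟩

section
variable {φ : Formula} {P Q : Finset ℕ} {M M' : KripkeModel} (hM : IsGrz M) (hM' : IsGrz M')
  (s0 : Pt φ P Q M M')
include hM hM'

theorem amal_grz : IsGrz (amal s0) := by
  have key : ∀ a b c : M'.W, M'.rel a b → M'.rel b c → c ≠ b → c ≠ a := by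
    rintro a b c h1 h2 h3 rfl
    exact h3 (hM'.antisymm _ _ h1 h2)
  refine ⟨fun x => Or.inl rfl, ?_, ?_, ?_⟩
  · rintro (s : Pt φ P Q M M') (t : Pt φ P Q M M') (u : Pt φ P Q M M')
      (rfl | ⟨h1, h2, h3, h4⟩ | ⟨h1, h2, h3⟩) (rfl | ⟨g1, g2, g3, g4⟩ | ⟨g1, g2, g3⟩)
    · exact Or.inl rfl
    · exact Or.inr (Or.inl ⟨g1, g2, g3, g4⟩)
    · exact Or.inr (Or.inr ⟨g1, g2, g3⟩)
    · exact Or.inr (Or.inl ⟨h1, h2, h3, h4⟩)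
    · exact Or.inr (Or.inl ⟨h1.trans g1, h2.trans g2, hM'.trans _ _ _ h3 g3, key _ _ _ h3 g3 g4⟩)
    · exact Or.inr (Or.inr ⟨h1 ▸ g1, h1 ▸ g2, hM'.trans _ _ _ h3 g3⟩)
    · exact Or.inr (Or.inr ⟨h1, h2, h3⟩)
    · exact Or.inr (Or.inr ⟨g1 ▸ h1, g1 ▸ h2, g2 ▸ h3⟩)
    · exact Or.inr (Or.inr ⟨g1.trans h1, hM.trans _ _ _ h2 g2,
        hM'.trans _ _ _ h3 (hM'.trans _ _ _ t.hx' g3)⟩)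
  · rintro (s : Pt φ P Q M M') (t : Pt φ P Q M M')
      (h | ⟨h1, h2, h3, h4⟩ | ⟨h1, h2, h3⟩) (g | ⟨g1, g2, g3, g4⟩ | ⟨g1, g2, g3⟩)
    · exact h
    · exact h
    · exact h
    · exact g.symm
    · exact absurd (hM'.antisymm _ _ g3 h3) h4
    · rw [h1] at g1; exact absurd g1 (lt_irrefl _)
    · exact g.symm
    · rw [g1] at h1; exact absurd h1 (lt_irrefl _)
    · exact absurd (h1.trans g1) (lt_irrefl _)
  · refine Subrelation.wf (r := InvImage (Prod.Lex (· < ·) fun a b => M'.rel b a ∧ a ≠ b)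
      (fun s : Pt φ P Q M M' => (rk φ M s.x, s.y'))) ?_
      (InvImage.wf _ (WellFounded.prod_lex wellFounded_lt hM'.wf))
    rintro (t : Pt φ P Q M M') (s : Pt φ P Q M M') ⟨h, hne⟩
    rcases h with h | ⟨h1, h2, h3, h4⟩ | ⟨h1, h2, h3⟩
    · exact absurd h.symm hne
    · refine Prod.lex_def.2 (Or.inr ⟨?_, h3, h4⟩)
      simp [h1]
    · exact Prod.lex_def.2 (Or.inl h1)

theorem amal_left (χ : Formula) : χ ∈ subfmls φ → ∀ s : Pt φ P Q M M',
    (χ.vsgn true ⊆ φ.vpos → χ.vsgn false ⊆ φ.vneg → M.Sat χ s.y → (amal s0).Sat χ s) ∧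
    (χ.vsgn false ⊆ φ.vpos → χ.vsgn true ⊆ φ.vneg → (amal s0).Sat χ s → M.Sat χ s.y) := by
  induction χ with
  | var p =>
    intro _ s
    constructor
    · intro h _ hs
      exact Or.inl ⟨h (by simp [vsgn]), hs⟩
    · intro _ h hs
      rcases hs with ⟨_, hs⟩ | ⟨hq, hs⟩
      · exact hs
      · by_contra hn
        exact s.hZ'.at.2 p (Finset.mem_sdiff.2 ⟨h (by simp [vsgn]), hq⟩) hn hs
  | bot => intro _ s; exact ⟨fun _ _ h => h, fun _ _ h => h⟩
  | imp a b iha ihb =>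
    intro hs s
    have iha := iha (sub_imp hs).1 s
    have ihb := ihb (sub_imp hs).2 s
    simp only [vsgn, Finset.union_subset_iff, Bool.not_true, Bool.not_false]
    refine ⟨fun h1 h2 h h' => ?_, fun h1 h2 h h' => ?_⟩
    · exact ihb.1 h1.2 h2.2 (h (iha.2 h1.1 h2.1 h'))
    · exact ihb.2 h1.2 h2.2 (h (iha.1 h1.1 h2.1 h'))
  | box a ih =>
    intro hs s
    have ih := ih (sub_box hs)
    simp only [vsgn]
    refine ⟨fun h1 h2 h => ?_, fun h1 h2 h => ?_⟩
    · have hx := rk_eq hM s.hx s.hr hs h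
      rintro (t : Pt φ P Q M M') (rfl | ⟨g1, g2, g3, g4⟩ | ⟨g1, g2, g3⟩)
      · exact (ih s).1 h1 h2 (h _ (hM.refl _))
      · exact (ih t).1 h1 h2 (hx _ (g1 ▸ t.hx))
      · exact (ih t).1 h1 h2 (hx _ (hM.trans _ _ _ g2 t.hx))
    · by_contra hn
      have ha : M.Sat a s.y := (ih s).2 h1 h2 (h s (Or.inl rfl))
      obtain ⟨u, hu1, hu2, hu3⟩ := rk_wit hM hs ha hn
      have hZ := s.hZ'
      have e := s.hr
      obtain ⟨k, hk⟩ : ∃ k, rk φ M s.x - 1 = k + 1 := ⟨rk φ M s.x - 2, by omega⟩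
      rw [hk] at hZ
      obtain ⟨u', hu', hz⟩ := hZ.2.1 u hu1
      have hz' := hz.mono (show rk φ M u ≤ k by omega)
      refine hu2 ((ih (Pt.mk1 hM hM' u u' hz')).2 h1 h2 (h _ (Or.inr (Or.inr ⟨?_, ?_, ?_⟩))))
      · show rk φ M u < rk φ M s.x
        omega
      · exact hM.trans _ _ _ s.hx hu1
      · exact hu'

theorem amal_right (χ : Formula) : ∀ s : Pt φ P Q M M',
    (χ.vsgn true ∩ P = ∅ → χ.vsgn false ∩ Q = ∅ → (amal s0).Sat χ s → M'.Sat χ s.y') ∧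
    (χ.vsgn false ∩ P = ∅ → χ.vsgn true ∩ Q = ∅ → M'.Sat χ s.y' → (amal s0).Sat χ s) := by
  simp only [← Finset.disjoint_iff_inter_eq_empty]
  induction χ with
  | var p =>
    intro s
    simp only [vsgn, Finset.disjoint_singleton_left]
    constructor
    · rintro h _ (⟨h1, h2⟩ | ⟨_, h2⟩)
      · exact s.hZ'.at.1 p (Finset.mem_sdiff.2 ⟨h1, h⟩) h2
      · exact h2
    · intro _ h hs
      exact Or.inr ⟨h, hs⟩
  | bot => intro s; exact ⟨fun _ _ h => h, fun _ _ h => h⟩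
  | imp a b iha ihb =>
    intro s
    have iha := iha s
    have ihb := ihb s
    simp only [vsgn, Finset.disjoint_union_left, Bool.not_true, Bool.not_false]
    refine ⟨fun h1 h2 h h' => ?_, fun h1 h2 h h' => ?_⟩
    · exact ihb.1 h1.2 h2.2 (h (iha.2 h1.1 h2.1 h'))
    · exact ihb.2 h1.2 h2.2 (h (iha.1 h1.1 h2.1 h'))
  | box a ih =>
    intro s
    simp only [vsgn]
    refine ⟨fun h1 h2 h => ?_, fun h1 h2 h => ?_⟩
    · intro z' hz'
      by_cases hne : z' = s.y'
      · subst hne; exact (ih s).1 h1 h2 (h s (Or.inl rfl))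
      have hZ := s.hZ
      obtain ⟨k, hk⟩ : ∃ k, rk φ M s.x = k + 1 := ⟨_, rfl⟩
      rw [hk] at hZ
      obtain ⟨z, hz, hzz⟩ := hZ.2.2 z' (hM'.trans _ _ _ s.hx' hz')
      rcases (rk_mono (φ := φ) hM hz).eq_or_lt with he | hl
      · let t : Pt φ P Q M M' := ⟨s.x, s.x', z, z', hz, hM'.trans _ _ _ s.hx' hz', s.hZ,
          by rw [hk]; exact hzz, he⟩
        exact (ih t).1 h1 h2 (h t (Or.inr (Or.inl ⟨rfl, rfl, hz', hne⟩)))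
      · let t : Pt φ P Q M M' := Pt.mk1 hM hM' z z' (hzz.mono (by omega))
        exact (ih t).1 h1 h2 (h t (Or.inr (Or.inr ⟨hl, hz, hz'⟩)))
    · rintro (t : Pt φ P Q M M') (rfl | ⟨g1, g2, g3, g4⟩ | ⟨g1, g2, g3⟩)
      · exact (ih s).2 h1 h2 (h _ (hM'.refl _))
      · exact (ih t).2 h1 h2 (h _ g3)
      · exact (ih t).2 h1 h2 (h _ (hM'.trans _ _ _ g3 t.hx'))

end

theorem main (φ : Formula) (P Q : Finset ℕ) : ∃ θ : Formula,
    IsULInterpolant TheoryGrz φ P Q θ ∧ θ.depth ≤ 3 * φ.boxCount + 3 := by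
  classical
  obtain ⟨L, hL, hC⟩ := exists_char (φ.vpos \ P) (φ.vneg \ Q) (3 * φ.boxCount + 1)
  let S := L.filter fun c => ∃ (M : KripkeModel) (w : M.W), IsGrz M ∧ M.Sat φ w ∧
    Chz (φ.vpos \ P) (φ.vneg \ Q) (3 * φ.boxCount + 1) M w c
  have hb : Bd (φ.vpos \ P) (φ.vneg \ Q) (3 * φ.boxCount + 1) (disjList S.toList) :=
    Bd.disj fun a ha => hL a (Finset.mem_filter.1 (Finset.mem_toList.1 ha)).1
  refine ⟨disjList S.toList, ⟨hb.1, hb.2.1, ?_, ?_⟩, hb.2.2.trans (by omega)⟩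
  · refine complete fun M hM w hw => ?_
    obtain ⟨c, hc, hcw⟩ := hC M w
    exact (sat_disj _ _ _).2 ⟨c, Finset.mem_toList.2 (Finset.mem_filter.2
      ⟨hc, M, w, hM, hw, hcw⟩), (hcw _ _).2 (Z.rfl' w)⟩
  · intro ψ h1 h2 hψ
    refine complete fun M' hM' w' hw' => ?_
    obtain ⟨c, hc, hs⟩ := (sat_disj _ _ _).1 hw'
    obtain ⟨_, M, w, hM, hw, hcw⟩ := Finset.mem_filter.1 (Finset.mem_toList.1 hc)
    have hz := ((hcw _ _).1 hs).mono (rk_le φ M w)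
    let s : Pt φ P Q M M' := Pt.mk1 hM hM' w w' hz
    have hl := (amal_left hM hM' s φ (mem_sub_self φ) s).1 (Finset.Subset.refl _)
      (Finset.Subset.refl _) hw
    exact (amal_right hM hM' s ψ s).1 h1 h2 (sound hψ (amal_grz hM hM' s) s hl)

end GrzULIP

/-- Grz enjoys ULIP, with interpolants of depth at most 3n(φ)+3. -/
theorem ulip_Grz : ULIP TheoryGrz ∧
    ∀ (φ : Formula) (P Q : Finset ℕ), ∃ θ : Formula,
      IsULInterpolant TheoryGrz φ P Q θ ∧ θ.depth ≤ 3 * φ.boxCount + 3 := by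
  exact ⟨fun φ P Q => (GrzULIP.main φ P Q).imp fun _ h => h.1, GrzULIP.main⟩
end
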